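/- Let f : ℝ^N × M^{m×N} → [0,+∞] be a normal integrand. For every x ∈ ℝ^N, if Zf(x,·) is finite everywhere, then Zf(x,·) is continuous on M^{m×N}. Consequently, if Zf is finite everywhere, then Zf is a Carathéodory integrand (measurable in x, continuous in ξ). -/

import Mathlib

open MeasureTheory Filter ENNReal Set

/-- The (sup-norm) gradient matrix of `φ` at `y`, as an `m × N` matrix. -/
noncomputable def grad {N m : ℕ} (φ : (Fin N → ℝ) → Fin m → ℝ) (y : Fin N → ℝ) :
    Fin m → Fin N → ℝ := fun i j => fderiv ℝ φ y (Pi.single j 1) i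

/-- The open unit cube `Y = (0,1)^N`. -/
def unitCube (N : ℕ) : Set (Fin N → ℝ) := Set.univ.pi fun _ => Set.Ioo 0 1

/-- A normal integrand: jointly measurable and lower semicontinuous in the matrix variable. -/
def NormalIntegrand {N m : ℕ} (f : (Fin N → ℝ) → (Fin m → Fin N → ℝ) → ℝ≥0∞) : Prop :=
  Measurable (Function.uncurry f) ∧ ∀ x, LowerSemicontinuous (f x)

/-- `W^{1,∞}_0(D;ℝ^m)` : Lipschitz maps vanishing on `∂D`. -/
def LipZero {N m : ℕ} (D : Set (Fin N → ℝ)) (φ : (Fin N → ℝ) → Fin m → ℝ) : Prop :=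
  (∃ K, LipschitzWith K φ) ∧ ∀ x ∈ frontier D, φ x = 0

/-- `Zf(x,ξ) = inf { ∫_Y f(x, ξ + ∇φ) : φ ∈ W^{1,∞}_0(Y;ℝ^m) }`. -/
noncomputable def Zfun {N m : ℕ} (f : (Fin N → ℝ) → (Fin m → Fin N → ℝ) → ℝ≥0∞)
    (x : Fin N → ℝ) (ξ : Fin m → Fin N → ℝ) : ℝ≥0∞ :=
  ⨅ (φ : (Fin N → ℝ) → Fin m → ℝ) (_ : LipZero (unitCube N) φ),
    ∫⁻ y in unitCube N, f x (ξ + grad φ y)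

/-! ### Gluing rescaled copies of a map on the unit cube -/

lemma LipschitzWith.indicator_of_eq_zero_frontier {E F : Type*} [NormedAddCommGroup E]
    [NormedSpace ℝ E] [NormedAddCommGroup F] {K : NNReal} {φ : E → F} {D : Set E}
    (h : LipschitzWith K φ) (h0 : ∀ x ∈ frontier D, φ x = 0) :
    LipschitzWith K (D.indicator φ) := by
  have key : ∀ y ∈ D, ∀ z ∉ D, dist (φ y) 0 ≤ K * dist y z := by
    intro y hy z hz
    obtain ⟨b, hb, hbD⟩ : (segment ℝ y z ∩ frontier D).Nonempty := by
      by_contra hne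
      have hsub : segment ℝ y z ⊆ interior D ∪ (closure D)ᶜ := by
        intro b hb
        by_contra hbD
        simp only [mem_union, mem_compl_iff, not_or, not_not] at hbD
        exact hne ⟨b, hb, hbD.2, hbD.1⟩
      have hy' : y ∈ interior D := (hsub (left_mem_segment ℝ y z)).resolve_right
        fun h => h (subset_closure hy)
      have hz' : z ∈ (closure D)ᶜ := (hsub (right_mem_segment ℝ y z)).resolve_left
        fun h => hz (interior_subset h)
      obtain ⟨b, -, h1, h2⟩ := (convex_segment (𝕜 := ℝ) y z).isPreconnected _ _ isOpen_interior
        isClosed_closure.isOpen_compl hsub ⟨y, left_mem_segment ℝ y z, hy'⟩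
        ⟨z, right_mem_segment ℝ y z, hz'⟩
      exact h2 (subset_closure (interior_subset h1))
    have h1 := h.dist_le_mul y b
    rw [h0 b hbD] at h1
    refine h1.trans ?_
    gcongr
    have := dist_add_dist_of_mem_segment hb
    linarith [dist_nonneg (x := b) (y := z)]
  refine LipschitzWith.of_dist_le_mul fun y z => ?_
  by_cases hy : y ∈ D <;> by_cases hz : z ∈ D
  · simpa [hy, hz] using h.dist_le_mul y z
  · simpa [hy, hz] using key y hy z hz
  · simpa [hy, hz, dist_comm] using key z hz y hy
  · simpa [hy, hz] using by positivity

lemma exists_lipschitzWith_glue {ι E F : Type*} [PseudoMetricSpace E] [NormedAddCommGroup F]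
    {K : NNReal} (S : ι → Set E) (hS : Pairwise (fun i j => Disjoint (S i) (S j)))
    (ψ : ι → E → F) (hψ : ∀ i, LipschitzWith K (ψ i)) (h0 : ∀ i, ∀ y ∉ S i, ψ i y = 0) :
    ∃ v : E → F, LipschitzWith (2 * K) v ∧ (∀ i, ∀ y ∈ S i, v y = ψ i y) ∧
      ∀ y, (∀ i, y ∉ S i) → v y = 0 := by
  classical
  let v : E → F := fun y => if h : ∃ i, y ∈ S i then ψ h.choose y else 0
  have hv : ∀ i, ∀ y ∈ S i, v y = ψ i y := by
    intro i y hy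
    have h : ∃ i, y ∈ S i := ⟨i, hy⟩
    have : h.choose = i := by
      by_contra hne
      exact Set.disjoint_left.1 (hS hne) h.choose_spec hy
    simp only [v, dif_pos h, this]
  have hv0 : ∀ y, (∀ i, y ∉ S i) → v y = 0 := by
    intro y hy
    have : ¬ ∃ i, y ∈ S i := by simpa using hy
    simp only [v, dif_neg this]
  refine ⟨v, ?_, hv, hv0⟩
  have hle : ∀ i y z, dist (ψ i y) (ψ i z) ≤ K * dist y z := fun i y z => (hψ i).dist_le_mul y z
  refine LipschitzWith.of_dist_le_mul fun y z => ?_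
  have hnn : (0 : ℝ) ≤ K * dist y z := by positivity
  push_cast
  by_cases hy : ∃ i, y ∈ S i <;> by_cases hz : ∃ j, z ∈ S j
  · obtain ⟨i, hi⟩ := hy
    obtain ⟨j, hj⟩ := hz
    rw [hv i y hi, hv j z hj]
    by_cases hij : i = j
    · subst hij
      linarith [hle i y z]
    · have h1 := h0 i z (Set.disjoint_right.1 (hS hij) hj)
      have h2 := h0 j y (Set.disjoint_left.1 (hS hij) hi)
      have h3 := hle i y z
      have h4 := hle j y z
      have h5 := dist_triangle (ψ i y) 0 (ψ j z)
      rw [h1] at h3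
      rw [h2] at h4
      linarith
  · obtain ⟨i, hi⟩ := hy
    have hz' : ∀ j, z ∉ S j := by simpa using hz
    rw [hv i y hi, hv0 z hz', ← h0 i z (hz' i)]
    linarith [hle i y z]
  · obtain ⟨j, hj⟩ := hz
    have hy' : ∀ j, y ∉ S j := by simpa using hy
    rw [hv j z hj, hv0 y hy', ← h0 j y (hy' j)]
    linarith [hle j y z]
  · rw [hv0 y (by simpa using hy), hv0 z (by simpa using hz)]
    simpa using by linarith

lemma isOpen_unitCube (N : ℕ) : IsOpen (unitCube N) :=
  isOpen_set_pi finite_univ fun _ _ => isOpen_Ioo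

lemma volume_unitCube (N : ℕ) : volume (unitCube N) = 1 := by
  simp [unitCube, Real.volume_pi_Ioo]

lemma closure_unitCube (N : ℕ) : closure (unitCube N) = Set.univ.pi fun _ => Set.Icc 0 1 := by
  simp [unitCube, closure_pi_set, closure_Ioo]

/-- The affine map sending the unit cube to the (sup-norm) ball of centre `c` and radius `r`. -/
def cubeMap {N : ℕ} (c : Fin N → ℝ) (r : ℝ) (z : Fin N → ℝ) : Fin N → ℝ :=
  (fun i => c i - r) + (2 * r) • z

lemma cubeMap_image_unitCube {N : ℕ} (c : Fin N → ℝ) {r : ℝ} (hr : 0 < r) :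
    cubeMap c r '' unitCube N = Metric.ball c r := by
  rw [ball_pi c hr]
  ext y
  simp only [mem_image, unitCube, Set.mem_pi, mem_univ, true_imp_iff, Real.ball_eq_Ioo, mem_Ioo]
  constructor
  · rintro ⟨z, hz, rfl⟩ i
    have := hz i
    simp only [cubeMap, Pi.add_apply, Pi.smul_apply, smul_eq_mul]
    constructor <;> nlinarith
  · intro h
    refine ⟨fun i => (y i - (c i - r)) / (2 * r), fun i => ⟨?_, ?_⟩, ?_⟩
    · have := (h i).1
      apply div_pos <;> linarith
    · rw [div_lt_one (by linarith)]
      linarith [(h i).2]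
    · ext i
      simp only [cubeMap, Pi.add_apply, Pi.smul_apply, smul_eq_mul]
      field_simp
      ring

lemma hasFDerivAt_cubeMap {N : ℕ} (c : Fin N → ℝ) (r : ℝ) (z : Fin N → ℝ) :
    HasFDerivAt (cubeMap c r) ((2 * r) • ContinuousLinearMap.id ℝ (Fin N → ℝ)) z :=
  ((hasFDerivAt_id z).const_smul (2 * r)).const_add _

lemma cubeMap_injective {N : ℕ} (c : Fin N → ℝ) {r : ℝ} (hr : 0 < r) :
    Function.Injective (cubeMap c r) := by
  intro z w h
  have := add_left_cancel (h : (fun i => c i - r) + (2 * r) • z = (fun i => c i - r) + (2 * r) • w)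
  exact smul_right_injective _ (by positivity : (2 * r) ≠ 0) this

lemma lintegral_ball_eq {N : ℕ} (c : Fin N → ℝ) {r : ℝ} (hr : 0 < r)
    (F : (Fin N → ℝ) → ℝ≥0∞) :
    ∫⁻ y in Metric.ball c r, F y =
      volume (Metric.ball c r) * ∫⁻ z in unitCube N, F (cubeMap c r z) := by
  have h (G : (Fin N → ℝ) → ℝ≥0∞) : ∫⁻ y in Metric.ball c r, G y =
      ENNReal.ofReal ((2 * r) ^ N) * ∫⁻ z in unitCube N, G (cubeMap c r z) := by
    rw [← cubeMap_image_unitCube c hr, lintegral_image_eq_lintegral_abs_det_fderiv_mul volume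
      (isOpen_unitCube N).measurableSet
      (fun z _ => (hasFDerivAt_cubeMap c r z).hasFDerivWithinAt) (cubeMap_injective c hr).injOn,
      ← lintegral_const_mul' _ _ ENNReal.ofReal_ne_top]
    have : |((2 * r) • ContinuousLinearMap.id ℝ (Fin N → ℝ)).det| = (2 * r) ^ N := by
      rw [ContinuousLinearMap.det, ContinuousLinearMap.toLinearMap_smul, LinearMap.det_smul]
      simp [abs_of_pos hr]
    simp only [this]
  have h1 := h 1
  simp only [Pi.one_apply, lintegral_one, Measure.restrict_apply, MeasurableSet.univ, univ_inter,
    volume_unitCube, mul_one] at h1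
  rw [h, h1]

lemma LipschitzWith.grad_add_ae {N m : ℕ} {K L : NNReal} {u v : (Fin N → ℝ) → Fin m → ℝ}
    (hu : LipschitzWith K u) (hv : LipschitzWith L v) :
    ∀ᵐ y, grad (u + v) y = grad u y + grad v y := by
  filter_upwards [hu.ae_differentiableAt (μ := volume), hv.ae_differentiableAt (μ := volume)]
    with y h1 h2
  ext i j
  simp [grad, fderiv_add h1 h2]

/-- The copy of `φ` on the ball of centre `c` and radius `r`, with the same gradients. -/
noncomputable def cubeCopy {N m : ℕ} (φ : (Fin N → ℝ) → Fin m → ℝ) (c : Fin N → ℝ) (r : ℝ)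
    (y : Fin N → ℝ) : Fin m → ℝ :=
  (2 * r) • φ ((2 * r)⁻¹ • (y - fun i => c i - r))

lemma cubeMap_inv {N : ℕ} (c : Fin N → ℝ) {r : ℝ} (hr : 0 < r) (y : Fin N → ℝ) :
    cubeMap c r ((2 * r)⁻¹ • (y - fun i => c i - r)) = y := by
  have : (2 * r) ≠ 0 := by positivity
  rw [cubeMap, smul_smul, mul_inv_cancel₀ this, one_smul, add_sub_cancel]

lemma cubeMap_inv' {N : ℕ} (c : Fin N → ℝ) {r : ℝ} (hr : 0 < r) (z : Fin N → ℝ) :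
    (2 * r)⁻¹ • (cubeMap c r z - fun i => c i - r) = z :=
  cubeMap_injective c hr (cubeMap_inv c hr _)

lemma lipschitzWith_cubeCopy {N m : ℕ} {K : NNReal} {φ : (Fin N → ℝ) → Fin m → ℝ}
    (h : LipschitzWith K φ) (c : Fin N → ℝ) {r : ℝ} (hr : 0 < r) :
    LipschitzWith K (cubeCopy φ c r) := by
  refine LipschitzWith.of_dist_le_mul fun y z => ?_
  have hr' : 0 < 2 * r := by positivity
  rw [cubeCopy, cubeCopy, dist_smul₀]
  calc ‖2 * r‖ * dist (φ _) (φ _) ≤ ‖2 * r‖ * (K * dist _ _) := by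
        gcongr
        exact h.dist_le_mul _ _
    _ = K * dist y z := by
        rw [dist_smul₀, dist_sub_right, norm_inv, Real.norm_of_nonneg hr'.le]
        field_simp

lemma fderiv_cubeCopy {N m : ℕ} (φ : (Fin N → ℝ) → Fin m → ℝ) (c : Fin N → ℝ) {r : ℝ}
    (hr : 0 < r) (z : Fin N → ℝ) :
    fderiv ℝ (cubeCopy φ c r) (cubeMap c r z) = fderiv ℝ φ z := by
  have hr' : 2 * r ≠ 0 := by positivity
  have := invertibleOfNonzero hr'
  change fderiv ℝ ((2 * r) • (fun y => (fun w' => φ ((2 * r)⁻¹ • w')) (y - fun i => c i - r))) _ = _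
  rw [fderiv_const_smul_of_invertible,
    fderiv_comp_sub (f := fun w' => φ ((2 * r)⁻¹ • w')) (fun i => c i - r),
    fderiv_comp_smul, cubeMap_inv' c hr,
    smul_smul, mul_inv_cancel₀ hr', one_smul]

/-- Inserting rescaled near-minimizers on the pieces of a piecewise affine map. -/
lemma Zfun_le_lintegral_of_ae_eventually {N m : ℕ}
    {f : (Fin N → ℝ) → (Fin m → Fin N → ℝ) → ℝ≥0∞} {x : Fin N → ℝ}
    (hfin : ∀ ξ, Zfun f x ξ ≠ ⊤) (ξ : Fin m → Fin N → ℝ) {F : Set (Fin m → Fin N → ℝ)}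
    (hF : F.Finite) {u : (Fin N → ℝ) → Fin m → ℝ} (hu : LipZero (unitCube N) u)
    (huF : ∀ᵐ y, ∃ η ∈ F, ∀ᶠ w in nhds y, grad u w = η) :
    Zfun f x ξ ≤ ∫⁻ y in unitCube N, Zfun f x (ξ + grad u y) := by
  refine ENNReal.le_of_forall_pos_le_add fun ε hε _ => ?_
  have hε' : (0 : ℝ≥0∞) < ε := by exact_mod_cast hε
  have hφ : ∀ ζ, ∃ φ : (Fin N → ℝ) → Fin m → ℝ, LipZero (unitCube N) φ ∧
      ∫⁻ y in unitCube N, f x (ζ + grad φ y) < Zfun f x ζ + ε := by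
    intro ζ
    have h := ENNReal.lt_add_right (hfin ζ) hε'.ne'
    conv at h => lhs; rw [Zfun]
    simpa only [iInf_lt_iff, exists_prop] using h
  choose φ hφ0 hφlt using hφ
  choose L hL using fun ζ => (hφ0 ζ).1
  obtain ⟨K, hK⟩ := (hF.image fun η => L (ξ + η)).bddAbove
  obtain ⟨Lu, hLu⟩ := hu.1
  let W : (Fin N → ℝ) → Set (Fin N → ℝ) := fun y => {w ∈ unitCube N | grad u w = grad u y}
  let O : Set (Fin N → ℝ) := {y ∈ unitCube N | grad u y ∈ F ∧ W y ∈ nhds y}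
  have hO : ∀ᵐ y, y ∈ unitCube N → y ∈ O := by
    filter_upwards [huF] with y hy hyY
    obtain ⟨η, hη, hev⟩ := hy
    have hself := hev.self_of_nhds
    refine ⟨hyY, hself ▸ hη, ?_⟩
    filter_upwards [hev, (isOpen_unitCube N).mem_nhds hyY] with w hw hwY
    exact ⟨hwY, hw.trans hself.symm⟩
  obtain ⟨t, r, htc, htO, hr, hnull, hdisj⟩ :=
    Besicovitch.exists_disjoint_closedBall_covering_ae (volume : Measure (Fin N → ℝ))
      (fun y => {r | Metric.closedBall y r ⊆ W y}) O (by
        intro y hy δ hδ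
        obtain ⟨ρ, hρ, hsub⟩ := Metric.nhds_basis_closedBall.mem_iff.1 hy.2.2
        refine ⟨min ρ (δ / 2), (Metric.closedBall_subset_closedBall (min_le_left _ _)).trans hsub,
          lt_min hρ (half_pos hδ), ?_⟩
        exact (min_le_right _ _).trans_lt (half_lt_self hδ)) (fun _ => 1) (fun _ _ => one_pos)
  have hr0 : ∀ i : t, 0 < r i := fun i => (hr i i.2).2.1
  have hrW : ∀ i : t, Metric.closedBall (i : Fin N → ℝ) (r i) ⊆ W i := fun i => (hr i i.2).1
  have : Countable t := htc
  let S : t → Set (Fin N → ℝ) := fun i => Metric.ball (i : Fin N → ℝ) (r i)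
  have hSW : ∀ i, S i ⊆ W i := fun i => Metric.ball_subset_closedBall.trans (hrW i)
  have hS : Pairwise fun i j => Disjoint (S i) (S j) := by
    intro i j hij
    exact (hdisj i.2 j.2 (fun h => hij (Subtype.ext h))).mono Metric.ball_subset_closedBall
      Metric.ball_subset_closedBall
  let φ' : t → (Fin N → ℝ) → Fin m → ℝ := fun i => (unitCube N).indicator (φ (ξ + grad u i))
  obtain ⟨v, hvL, hvS, hv0⟩ := exists_lipschitzWith_glue (K := K) S hS
    (fun i => cubeCopy (φ' i) i (r i))
    (fun i => lipschitzWith_cubeCopy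
      (((hL _).weaken (hK ⟨_, (htO i.2).2.1, rfl⟩)).indicator_of_eq_zero_frontier (hφ0 _).2)
      _ (hr0 i))
    (fun i y hy => by
      have : (2 * r i)⁻¹ • (y - fun k => (i : Fin N → ℝ) k - r i) ∉ unitCube N := by
        intro h
        apply hy
        change y ∈ Metric.ball _ _
        rw [← cubeMap_image_unitCube _ (hr0 i)]
        exact ⟨_, h, cubeMap_inv _ (hr0 i) y⟩
      simp only [cubeCopy, φ', Set.indicator_of_notMem this, smul_zero])
  have huv : LipZero (unitCube N) (u + v) := by
    refine ⟨⟨_, hLu.add hvL⟩, fun y hy => ?_⟩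
    have hyY : y ∉ unitCube N := fun h => by
      rw [(isOpen_unitCube N).frontier_eq] at hy
      exact hy.2 h
    simp [hu.2 y hy, hv0 y fun i hi => hyY (hSW i hi).1]
  have hgrad : ∀ i : t, ∀ z ∈ unitCube N,
      grad v (cubeMap i (r i) z) = grad (φ (ξ + grad u i)) z := by
    intro i z hz
    have hmem : cubeMap i (r i) z ∈ S i := by
      change _ ∈ Metric.ball _ _
      rw [← cubeMap_image_unitCube _ (hr0 i)]
      exact ⟨z, hz, rfl⟩
    have h1 : v =ᶠ[nhds (cubeMap i (r i) z)] cubeCopy (φ' i) i (r i) := by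
      filter_upwards [Metric.isOpen_ball.mem_nhds hmem] with w hw using hvS i w hw
    have h2 : φ' i =ᶠ[nhds z] φ (ξ + grad u i) := by
      filter_upwards [(isOpen_unitCube N).mem_nhds hz] with w hw
      simp [φ', hw]
    ext k l
    simp only [grad]
    rw [h1.fderiv_eq, fderiv_cubeCopy _ _ (hr0 i), h2.fderiv_eq]
  have hball : ∀ i : t, ∫⁻ y in S i, f x (ξ + grad (u + v) y) ≤
      ∫⁻ y in S i, (Zfun f x (ξ + grad u y) + ε) := by
    intro i
    calc ∫⁻ y in S i, f x (ξ + grad (u + v) y)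
        = ∫⁻ y in S i, f x (ξ + grad u i + grad v y) := by
          refine lintegral_congr_ae ?_
          filter_upwards [ae_restrict_of_ae (hLu.grad_add_ae hvL),
            ae_restrict_mem Metric.isOpen_ball.measurableSet] with y h1 h2
          rw [h1, (hSW i h2).2, add_assoc]
      _ = volume (S i) * ∫⁻ z in unitCube N, f x (ξ + grad u i + grad (φ (ξ + grad u i)) z) := by
          rw [lintegral_ball_eq _ (hr0 i)]
          congr 1
          refine setLIntegral_congr_fun (isOpen_unitCube N).measurableSet fun z hz => ?_
          simp only [hgrad i z hz]
      _ ≤ volume (S i) * (Zfun f x (ξ + grad u i) + ε) := by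
          gcongr
          exact (hφlt _).le
      _ = ∫⁻ y in S i, (Zfun f x (ξ + grad u y) + ε) := by
          rw [mul_comm, ← setLIntegral_const]
          refine setLIntegral_congr_fun Metric.isOpen_ball.measurableSet fun y hy => ?_
          simp only [(hSW i hy).2]
  have hcover : (unitCube N : Set (Fin N → ℝ)) ≤ᵐ[volume] ⋃ i, S i := by
    have hsph : ∀ᵐ y, ∀ i : t, y ∉ Metric.sphere (i : Fin N → ℝ) (r i) := by
      rw [ae_all_iff]
      intro i
      exact measure_eq_zero_iff_ae_notMem.1 (Measure.addHaar_sphere_of_ne_zero _ _ (hr0 i).ne')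
    filter_upwards [hO, measure_eq_zero_iff_ae_notMem.1 hnull, hsph] with y h1 h2 h3 h4
    have h5 : y ∈ ⋃ i ∈ t, Metric.closedBall i (r i) := by
      by_contra h
      exact h2 ⟨h1 h4, h⟩
    simp only [mem_iUnion, exists_prop] at h5
    obtain ⟨i, hi, hy⟩ := h5
    refine mem_iUnion.2 ⟨⟨i, hi⟩, ?_⟩
    rw [← Metric.ball_union_sphere] at hy
    exact hy.resolve_right (h3 ⟨i, hi⟩)
  calc Zfun f x ξ ≤ ∫⁻ y in unitCube N, f x (ξ + grad (u + v) y) :=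
        iInf₂_le (u + v) huv
    _ ≤ ∫⁻ y in ⋃ i, S i, f x (ξ + grad (u + v) y) := lintegral_mono_set' hcover
    _ ≤ ∑' i, ∫⁻ y in S i, f x (ξ + grad (u + v) y) := lintegral_iUnion_le _ _
    _ ≤ ∑' i, ∫⁻ y in S i, (Zfun f x (ξ + grad u y) + ε) := ENNReal.tsum_le_tsum hball
    _ = ∫⁻ y in ⋃ i, S i, (Zfun f x (ξ + grad u y) + ε) :=
        (lintegral_iUnion (fun i => Metric.isOpen_ball.measurableSet) hS _).symm
    _ ≤ ∫⁻ y in unitCube N, (Zfun f x (ξ + grad u y) + ε) :=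
        lintegral_mono_set (iUnion_subset fun i => (hSW i).trans fun y hy => hy.1)
    _ = (∫⁻ y in unitCube N, Zfun f x (ξ + grad u y)) + ε := by
        rw [lintegral_add_right _ measurable_const, setLIntegral_const, volume_unitCube, mul_one]

/-! ### Piecewise affine functions -/

/-- `u` is locally affine almost everywhere, with slopes in `F`. -/
def PiecewiseAffine {N : ℕ} (F : Set ((Fin N → ℝ) →L[ℝ] ℝ)) (u : (Fin N → ℝ) → ℝ) : Prop :=
  ∀ᵐ y, ∃ ℓ ∈ F, ∀ᶠ w in nhds y, u w = u y + ℓ (w - y)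

namespace PiecewiseAffine

variable {N : ℕ} {F G : Set ((Fin N → ℝ) →L[ℝ] ℝ)} {u v : (Fin N → ℝ) → ℝ}

lemma mono (h : PiecewiseAffine F u) (hFG : F ⊆ G) : PiecewiseAffine G u := by
  filter_upwards [h] with y ⟨ℓ, hℓ, h⟩ using ⟨ℓ, hFG hℓ, h⟩

lemma affine (ℓ : (Fin N → ℝ) →L[ℝ] ℝ) (c : ℝ) :
    PiecewiseAffine {ℓ} fun y => ℓ y + c := by
  refine Eventually.of_forall fun y => ⟨ℓ, rfl, Eventually.of_forall fun w => ?_⟩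
  simp only [map_sub]
  ring

lemma add (hu : PiecewiseAffine F u) (hv : PiecewiseAffine G v) :
    PiecewiseAffine (Set.image2 (· + ·) F G) (fun y => u y + v y) := by
  filter_upwards [hu, hv] with y ⟨ℓ, hℓ, h⟩ ⟨ℓ', hℓ', h'⟩
  refine ⟨ℓ + ℓ', ⟨ℓ, hℓ, ℓ', hℓ', rfl⟩, ?_⟩
  filter_upwards [h, h'] with w h1 h2
  rw [h1, h2, add_apply]
  ring

lemma const_mul (hu : PiecewiseAffine F u) (c : ℝ) :
    PiecewiseAffine ((fun ℓ => c • ℓ) '' F) (fun y => c * u y) := by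
  filter_upwards [hu] with y ⟨ℓ, hℓ, h⟩
  refine ⟨c • ℓ, ⟨ℓ, hℓ, rfl⟩, ?_⟩
  filter_upwards [h] with w h1
  rw [h1, smul_apply, smul_eq_mul]
  ring

lemma exists_finite_sum {ι : Type*} (s : Finset ι) (u : ι → (Fin N → ℝ) → ℝ)
    (h : ∀ i ∈ s, ∃ F : Set ((Fin N → ℝ) →L[ℝ] ℝ), F.Finite ∧ PiecewiseAffine F (u i)) :
    ∃ F : Set ((Fin N → ℝ) →L[ℝ] ℝ), F.Finite ∧ PiecewiseAffine F fun y => ∑ i ∈ s, u i y := by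
  classical
  induction s using Finset.induction_on with
  | empty => exact ⟨{0}, finite_singleton _, by simpa using affine (N := N) 0 0⟩
  | insert a s ha ih =>
    obtain ⟨F, hF, hu⟩ := h a (Finset.mem_insert_self a s)
    obtain ⟨G, hG, hv⟩ := ih fun i hi => h i (Finset.mem_insert_of_mem hi)
    refine ⟨_, hF.image2 (· + ·) hG, ?_⟩
    simpa only [Finset.sum_insert ha] using hu.add hv

lemma ae_notMem_crossing (u v : (Fin N → ℝ) → ℝ) :
    ∀ᵐ y, ¬ (u y = v y ∧ ∃ ℓ ℓ' : (Fin N → ℝ) →L[ℝ] ℝ, ℓ ≠ ℓ' ∧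
      (∀ᶠ w in nhds y, u w = u y + ℓ (w - y)) ∧ ∀ᶠ w in nhds y, v w = v y + ℓ' (w - y)) := by
  rw [ae_iff]
  simp only [not_not]
  refine measure_null_of_locally_null _ fun y hy => ?_
  obtain ⟨huv, ℓ, ℓ', hne, h, h'⟩ := hy
  refine ⟨{w | u w = v w ∧ u w = u y + ℓ (w - y) ∧ v w = v y + ℓ' (w - y)}, ?_, ?_⟩
  · filter_upwards [mem_nhdsWithin_of_mem_nhds h, mem_nhdsWithin_of_mem_nhds h',
      self_mem_nhdsWithin] with w h1 h2 h3 using ⟨h3.1, h1, h2⟩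
  · have hker : (ℓ - ℓ').ker ≠ ⊤ := by
      intro htop
      apply hne
      ext1 w
      have : w ∈ (ℓ - ℓ').ker := htop ▸ Submodule.mem_top
      simpa [sub_eq_zero] using this
    have h0 := Measure.addHaar_submodule (volume : Measure (Fin N → ℝ)) _ hker
    refine measure_mono_null (t := (fun w => w + -y) ⁻¹' ((ℓ - ℓ').ker : Set (Fin N → ℝ))) ?_ ?_
    · rintro w ⟨h1, h2, h3⟩
      have : ℓ (w - y) = ℓ' (w - y) := by linarith
      simp only [mem_preimage, SetLike.mem_coe, LinearMap.mem_ker, ← sub_eq_add_neg]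
      simpa [sub_eq_zero] using this
    · rwa [measure_preimage_add_right]

lemma inf (hu : PiecewiseAffine F u) (hv : PiecewiseAffine F v) :
    PiecewiseAffine F (fun y => min (u y) (v y)) := by
  filter_upwards [hu, hv, ae_notMem_crossing u v] with y ⟨ℓ, hℓ, h⟩ ⟨ℓ', hℓ', h'⟩ hcr
  have hc : ∀ (a : ℝ) (ℓ : (Fin N → ℝ) →L[ℝ] ℝ), ContinuousAt (fun w => a + ℓ (w - y)) y :=
    fun a ℓ => by fun_prop
  rcases lt_trichotomy (u y) (v y) with hlt | heq | hlt
  · refine ⟨ℓ, hℓ, ?_⟩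
    have := (hc (u y) ℓ).eventually_lt (hc (v y) ℓ') (by simpa using hlt)
    filter_upwards [h, h', this] with w h1 h2 h3
    rw [min_eq_left hlt.le, min_eq_left (by rw [h1, h2]; exact h3.le), h1]
  · have hℓℓ : ℓ = ℓ' := by
      by_contra hne
      exact hcr ⟨heq, ℓ, ℓ', hne, h, h'⟩
    refine ⟨ℓ, hℓ, ?_⟩
    filter_upwards [h, h'] with w h1 h2
    rw [h1, h2, ← heq, ← hℓℓ, min_self, min_self]
  · refine ⟨ℓ', hℓ', ?_⟩
    have := (hc (v y) ℓ').eventually_lt (hc (u y) ℓ) (by simpa using hlt)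
    filter_upwards [h, h', this] with w h1 h2 h3
    rw [min_eq_right hlt.le, min_eq_right (by rw [h1, h2]; exact h3.le), h2]

lemma sup (hu : PiecewiseAffine F u) (hv : PiecewiseAffine F v) :
    PiecewiseAffine F (fun y => max (u y) (v y)) := by
  have h := ((hu.const_mul (-1)).inf ((hv.const_mul (-1)))).const_mul (-1)
  simp only [neg_one_mul, min_neg_neg, neg_neg, image_image] at h
  refine h.mono ?_
  rintro _ ⟨ℓ, hℓ, rfl⟩
  simpa only [smul_smul, neg_mul_neg, one_mul, one_smul] using hℓ

lemma finset_inf' {ι : Type*} {s : Finset ι} (hs : s.Nonempty) {u : ι → (Fin N → ℝ) → ℝ}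
    (h : ∀ i ∈ s, PiecewiseAffine F (u i)) :
    PiecewiseAffine F fun y => s.inf' hs fun i => u i y := by
  classical
  induction hs using Finset.Nonempty.cons_induction with
  | singleton a => simpa using h a (by simp)
  | cons a s ha hs ih =>
    simp only [Finset.inf'_cons hs]
    exact (h a (by simp)).inf (ih fun i hi => h i (by simp [hi]))

lemma finset_sup' {ι : Type*} {s : Finset ι} (hs : s.Nonempty) {u : ι → (Fin N → ℝ) → ℝ}
    (h : ∀ i ∈ s, PiecewiseAffine F (u i)) :
    PiecewiseAffine F fun y => s.sup' hs fun i => u i y := by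
  classical
  induction hs using Finset.Nonempty.cons_induction with
  | singleton a => simpa using h a (by simp)
  | cons a s ha hs ih =>
    simp only [Finset.sup'_cons hs]
    exact (h a (by simp)).sup (ih fun i hi => h i (by simp [hi]))

/-- The matrices whose rows represent functionals taken from given sets. -/
def rowMatrices {m : ℕ} (F : Fin m → Set ((Fin N → ℝ) →L[ℝ] ℝ)) : Set (Fin m → Fin N → ℝ) :=
  (fun (ℓ : Fin m → (Fin N → ℝ) →L[ℝ] ℝ) i j => ℓ i (Pi.single j 1)) '' Set.pi univ F

lemma finite_rowMatrices {m : ℕ} {F : Fin m → Set ((Fin N → ℝ) →L[ℝ] ℝ)}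
    (hF : ∀ i, (F i).Finite) : (rowMatrices F).Finite :=
  (Set.Finite.pi hF).image _

lemma ae_eventually_grad {m : ℕ} {F : Fin m → Set ((Fin N → ℝ) →L[ℝ] ℝ)}
    {u : (Fin N → ℝ) → Fin m → ℝ} (h : ∀ i, PiecewiseAffine (F i) fun y => u y i) :
    ∀ᵐ y, ∃ η ∈ rowMatrices F, ∀ᶠ w in nhds y, grad u w = η := by
  filter_upwards [ae_all_iff.2 h] with y hy
  choose ℓ hℓ hev using hy
  refine ⟨_, ⟨ℓ, fun i _ => hℓ i, rfl⟩, ?_⟩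
  filter_upwards [(eventually_all.2 hev).eventually_nhds] with w hw
  have h1 : HasFDerivAt (fun z => fun i => u y i + ℓ i (z - y)) (ContinuousLinearMap.pi ℓ) w := by
    rw [hasFDerivAt_pi]
    intro i
    exact ((ℓ i).hasFDerivAt.comp w ((hasFDerivAt_id w).sub_const y)).const_add _
  have h2 : u =ᶠ[nhds w] fun z => fun i => u y i + ℓ i (z - y) := by
    filter_upwards [hw] with z hz using funext hz
  ext i j
  simp [grad, (h1.congr_of_eventuallyEq h2).fderiv]

end PiecewiseAffine

/-! ### Separate convexity -/

lemma exists_lipschitzWith_finset_sup' {ι E : Type*} [PseudoMetricSpace E] {s : Finset ι}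
    (hs : s.Nonempty) {u : ι → E → ℝ} (h : ∀ i ∈ s, ∃ K, LipschitzWith K (u i)) :
    ∃ K, LipschitzWith K fun y => s.sup' hs fun i => u i y := by
  induction hs using Finset.Nonempty.cons_induction with
  | singleton a => simpa using h a (by simp)
  | cons a s ha hs ih =>
    simp only [Finset.sup'_cons hs]
    obtain ⟨K, hK⟩ := h a (by simp)
    obtain ⟨L, hL⟩ := ih fun i hi => h i (by simp [hi])
    exact ⟨_, hK.max hL⟩

lemma exists_lipschitzWith_finset_inf' {ι E : Type*} [PseudoMetricSpace E] {s : Finset ι}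
    (hs : s.Nonempty) {u : ι → E → ℝ} (h : ∀ i ∈ s, ∃ K, LipschitzWith K (u i)) :
    ∃ K, LipschitzWith K fun y => s.inf' hs fun i => u i y := by
  induction hs using Finset.Nonempty.cons_induction with
  | singleton a => simpa using h a (by simp)
  | cons a s ha hs ih =>
    simp only [Finset.inf'_cons hs]
    obtain ⟨K, hK⟩ := h a (by simp)
    obtain ⟨L, hL⟩ := ih fun i hi => h i (by simp [hi])
    exact ⟨_, hK.min hL⟩

lemma exists_lipschitzWith_affine {N : ℕ} (ℓ : (Fin N → ℝ) →L[ℝ] ℝ) (c : ℝ) :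
    ∃ K, LipschitzWith K fun y => ℓ y + c :=
  ⟨_, ℓ.lipschitz.add (LipschitzWith.const c)⟩

/-- A sawtooth with `k + 1` teeth on `[0, 1]`, with slopes `(1 - b) * s` and `-b * s`. -/
noncomputable def sawtooth (s b : ℝ) (k : ℕ) (t : ℝ) : ℝ :=
  max 0 ((Finset.range (k + 1)).sup' ⟨0, by simp⟩ fun p =>
    min ((1 - b) * s * (t - p / (k + 1))) (b * s * ((p + 1) / (k + 1) - t)))

section sawtooth

variable {s b t : ℝ} {k p : ℕ}

lemma sawtooth_nonneg : 0 ≤ sawtooth s b k t := le_max_left _ _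

lemma sawtooth_eq (hs : 0 < s) (hb : 0 < b) (hb1 : b < 1) (hp : p ≤ k)
    (h1 : p / (k + 1) ≤ t) (h2 : t ≤ (p + 1) / (k + 1)) :
    sawtooth s b k t =
      min ((1 - b) * s * (t - p / (k + 1))) (b * s * ((p + 1) / (k + 1) - t)) := by
  have hk : (0 : ℝ) < k + 1 := by positivity
  have hα : 0 < (1 - b) * s := mul_pos (by linarith) hs
  have hβ : 0 < b * s := mul_pos hb hs
  have h0 : 0 ≤ min ((1 - b) * s * (t - p / (k + 1))) (b * s * ((p + 1) / (k + 1) - t)) :=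
    le_min (mul_nonneg hα.le (by linarith)) (mul_nonneg hβ.le (by linarith))
  refine le_antisymm (max_le h0 (Finset.sup'_le _ _ fun q hq => ?_)) ?_
  · rcases lt_trichotomy q p with hqp | rfl | hqp
    · refine (min_le_right _ _).trans (le_trans ?_ h0)
      have : ((q : ℝ) + 1) / (k + 1) ≤ p / (k + 1) := by
        gcongr
        exact_mod_cast hqp
      exact mul_nonpos_of_nonneg_of_nonpos hβ.le (by linarith)
    · exact le_rfl
    · refine (min_le_left _ _).trans (le_trans ?_ h0)
      have : ((p : ℝ) + 1) / (k + 1) ≤ q / (k + 1) := by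
        gcongr
        exact_mod_cast hqp
      exact mul_nonpos_of_nonneg_of_nonpos hα.le (by linarith)
  · exact (Finset.le_sup' (fun p : ℕ => min ((1 - b) * s * (t - p / (k + 1)))
      (b * s * ((p + 1) / (k + 1) - t))) (Finset.mem_range.2 (Nat.lt_succ_of_le hp))).trans
      (le_max_right _ _)

lemma sawtooth_eq_rise (hs : 0 < s) (hb : 0 < b) (hb1 : b < 1) (hp : p ≤ k)
    (h1 : p / (k + 1) ≤ t) (h2 : t ≤ (p + b) / (k + 1)) :
    sawtooth s b k t = (1 - b) * s * (t - p / (k + 1)) := by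
  have hk : (0 : ℝ) < k + 1 := by positivity
  rw [sawtooth_eq hs hb hb1 hp h1 (h2.trans (by gcongr)), min_eq_left]
  have h3 : t * (k + 1) ≤ p + b := (le_div_iff₀ hk).1 h2
  have h4 : (1 - b) * (t - p / (k + 1)) ≤ b * ((p + 1) / (k + 1) - t) := by
    rw [← sub_nonneg]
    have : b * ((p + 1) / (k + 1) - t) - (1 - b) * (t - p / (k + 1)) =
      (p + b - t * (k + 1)) / (k + 1) := by
      field_simp
      ring
    rw [this]
    exact div_nonneg (by linarith) hk.le
  nlinarith

lemma sawtooth_eq_fall (hs : 0 < s) (hb : 0 < b) (hb1 : b < 1) (hp : p ≤ k)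
    (h1 : (p + b) / (k + 1) ≤ t) (h2 : t ≤ (p + 1) / (k + 1)) :
    sawtooth s b k t = b * s * ((p + 1) / (k + 1) - t) := by
  have hk : (0 : ℝ) < k + 1 := by positivity
  rw [sawtooth_eq hs hb hb1 hp (le_trans (by gcongr; linarith) h1) h2, min_eq_right]
  have h3 : p + b ≤ t * (k + 1) := (div_le_iff₀ hk).1 h1
  have h4 : b * ((p + 1) / (k + 1) - t) ≤ (1 - b) * (t - p / (k + 1)) := by
    rw [← sub_nonneg]
    have : (1 - b) * (t - p / (k + 1)) - b * ((p + 1) / (k + 1) - t) =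
      (t * (k + 1) - (p + b)) / (k + 1) := by
      field_simp
      ring
    rw [this]
    exact div_nonneg (by linarith) hk.le
  nlinarith

lemma sawtooth_le (hs : 0 < s) (hb : 0 < b) (hb1 : b < 1) (hp : p ≤ k)
    (h1 : p / (k + 1) ≤ t) (h2 : t ≤ (p + 1) / (k + 1)) : sawtooth s b k t ≤ s / (k + 1) := by
  have hk : (0 : ℝ) < k + 1 := by positivity
  rw [sawtooth_eq hs hb hb1 hp h1 h2]
  refine (min_le_left _ _).trans ?_
  have h3 : t - p / (k + 1) ≤ 1 / (k + 1) := by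
    have : ((p : ℝ) + 1) / (k + 1) = p / (k + 1) + 1 / (k + 1) := by ring
    linarith
  calc (1 - b) * s * (t - p / (k + 1)) ≤ 1 * s * (1 / (k + 1)) := by
        gcongr
        linarith
    _ = s / (k + 1) := by ring

end sawtooth

/-- The sup-norm distance to the boundary of the unit cube, for points of that cube. -/
noncomputable def cubeDist {N : ℕ} [Nonempty (Fin N)] (y : Fin N → ℝ) : ℝ :=
  Finset.univ.inf' Finset.univ_nonempty fun l => min (y l) (1 - y l)

lemma continuous_cubeDist {N : ℕ} [Nonempty (Fin N)] : Continuous (cubeDist (N := N)) :=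
  Continuous.finset_inf'_apply _ fun l _ => by fun_prop

lemma cubeDist_eq_zero {N : ℕ} [Nonempty (Fin N)] {y : Fin N → ℝ}
    (hy : y ∈ frontier (unitCube N)) : cubeDist y = 0 := by
  rw [(isOpen_unitCube N).frontier_eq, closure_unitCube] at hy
  obtain ⟨h1, h2⟩ := hy
  refine le_antisymm ?_ (Finset.le_inf' _ _ fun l _ => ?_)
  · simp only [unitCube, Set.mem_pi, mem_univ, true_imp_iff, not_forall, mem_Ioo] at h2
    obtain ⟨l, hl⟩ := h2
    refine (Finset.inf'_le _ (Finset.mem_univ l)).trans ?_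
    by_cases h : 0 < y l
    · exact (min_le_right _ _).trans (by
        have : ¬ y l < 1 := fun h' => hl ⟨h, h'⟩
        linarith)
    · exact (min_le_left _ _).trans (not_lt.1 h)
  · have := h1 l (mem_univ l)
    exact le_min this.1 (by linarith [this.2])

lemma volume_slab_le {N : ℕ} (j : Fin N) (A : Set ℝ) :
    volume {y ∈ unitCube N | y j ∈ A} ≤ volume A := by
  calc volume {y ∈ unitCube N | y j ∈ A}
      ≤ volume (Set.univ.pi (Function.update (fun _ => Ioo (0 : ℝ) 1) j A)) := by
        refine measure_mono fun y hy l _ => ?_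
        by_cases h : l = j
        · subst h
          simpa using hy.2
        · simpa [h] using hy.1 l (mem_univ l)
    _ = volume A := by
        rw [volume_pi_pi, Finset.prod_eq_single j]
        · simp
        · intro l _ hl
          simp [hl]
        · simp

lemma volume_cubeDist_le {N : ℕ} [Nonempty (Fin N)] (δ : ℝ) :
    volume {y ∈ unitCube N | cubeDist y ≤ δ} ≤ N * (2 * ENNReal.ofReal δ) := by
  have hsub : {y ∈ unitCube N | cubeDist y ≤ δ} ⊆
      ⋃ l : Fin N, ({y ∈ unitCube N | y l ∈ Icc 0 δ} ∪ {y ∈ unitCube N | y l ∈ Icc (1 - δ) 1}) := by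
    rintro y ⟨hy, hd⟩
    simp only [cubeDist, Finset.inf'_le_iff] at hd
    obtain ⟨l, -, hl⟩ := hd
    have := hy l (mem_univ l)
    refine mem_iUnion.2 ⟨l, ?_⟩
    rcases min_le_iff.1 hl with h | h
    · exact Or.inl ⟨hy, this.1.le, h⟩
    · exact Or.inr ⟨hy, by linarith, this.2.le⟩
  calc _ ≤ _ := measure_mono hsub
    _ ≤ ∑ l : Fin N, volume ({y ∈ unitCube N | y l ∈ Icc 0 δ} ∪
          {y ∈ unitCube N | y l ∈ Icc (1 - δ) 1}) := measure_iUnion_fintype_le _ _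
    _ ≤ ∑ l : Fin N, 2 * ENNReal.ofReal δ := by
        refine Finset.sum_le_sum fun l _ => (measure_union_le _ _).trans ?_
        rw [two_mul]
        refine add_le_add ((volume_slab_le _ _).trans ?_) ((volume_slab_le _ _).trans ?_) <;> simp
    _ = _ := by simp

lemma volume_teeth_le {N : ℕ} (j : Fin N) (k : ℕ) {c e : ℝ} :
    volume {y ∈ unitCube N | ∃ p ≤ k, y j ∈ Ioo (((p : ℝ) + c) / (k + 1)) ((p + e) / (k + 1))} ≤
      ENNReal.ofReal (e - c) := by
  have hk : (0 : ℝ) < k + 1 := by positivity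
  calc _ ≤ volume (⋃ p ∈ Finset.range (k + 1),
          {y ∈ unitCube N | y j ∈ Ioo (((p : ℝ) + c) / (k + 1)) ((p + e) / (k + 1))}) := by
        refine measure_mono ?_
        rintro y ⟨hy, p, hp, h⟩
        simp only [mem_iUnion]
        exact ⟨p, Finset.mem_range.2 (Nat.lt_succ_of_le hp), hy, h⟩
    _ ≤ ∑ p ∈ Finset.range (k + 1),
          volume {y ∈ unitCube N | y j ∈ Ioo (((p : ℝ) + c) / (k + 1)) ((p + e) / (k + 1))} :=
        measure_biUnion_finset_le _ _
    _ ≤ ∑ p ∈ Finset.range (k + 1), ENNReal.ofReal ((e - c) / (k + 1)) := by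
        refine Finset.sum_le_sum fun p _ => (volume_slab_le _ _).trans ?_
        rw [Real.volume_Ioo]
        refine (congrArg ENNReal.ofReal ?_).le
        ring
    _ = ENNReal.ofReal (e - c) := by
        rw [Finset.sum_const, Finset.card_range, nsmul_eq_mul, ← ENNReal.ofReal_natCast,
          ← ENNReal.ofReal_mul (by positivity)]
        congr 1
        push_cast
        field_simp

lemma grad_single {N m : ℕ} (i : Fin m) (j : Fin N) {u : (Fin N → ℝ) → ℝ} {c e : ℝ}
    {y : Fin N → ℝ} (h : ∀ᶠ w in nhds y, u w = c * (w j - e)) :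
    grad (fun w => Pi.single i (u w)) y = c • Pi.single i (Pi.single j 1) := by
  have h1 : HasFDerivAt (fun w : Fin N → ℝ => c * (w j - e))
      (c • ContinuousLinearMap.proj (R := ℝ) (φ := fun _ : Fin N => ℝ) j) y :=
    (((ContinuousLinearMap.proj (R := ℝ) (φ := fun _ : Fin N => ℝ) j).hasFDerivAt).sub_const
      e).const_mul c
  have h2 := h1.congr_of_eventuallyEq h
  have h3 := (ContinuousLinearMap.single ℝ (fun _ : Fin m => ℝ) i).hasFDerivAt.comp y h2
  ext i' j'
  have h4 : fderiv ℝ (fun w => (Pi.single i (u w) : Fin m → ℝ)) y = _ := h3.fderiv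
  simp only [grad, h4]
  by_cases hi : i' = i
  · subst hi
    simp [Pi.single_apply, eq_comm]
  · simp [hi]

/-- The slopes of the components of the laminate built from `sawtooth` and `cubeDist`. -/
noncomputable def laminateSlopes {N : ℕ} (j : Fin N) (s b : ℝ) :
    Set ((Fin N → ℝ) →L[ℝ] ℝ) :=
  ({0, ((1 - b) * s) • ContinuousLinearMap.proj j, (-(b * s)) • ContinuousLinearMap.proj j} ∪
    Set.range fun l : Fin N => ContinuousLinearMap.proj (R := ℝ) (φ := fun _ : Fin N => ℝ) l) ∪
    Set.range fun l : Fin N => -ContinuousLinearMap.proj (R := ℝ) (φ := fun _ : Fin N => ℝ) l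

lemma finite_laminateSlopes {N : ℕ} (j : Fin N) (s b : ℝ) : (laminateSlopes j s b).Finite :=
  ((toFinite _).union (finite_range _)).union (finite_range _)

/-- A scalar function vanishing on the boundary of the cube, equal to a sawtooth of `y j` away
from the boundary. -/
noncomputable def laminate {N : ℕ} [Nonempty (Fin N)] (j : Fin N) (s b : ℝ) (k : ℕ)
    (y : Fin N → ℝ) : ℝ :=
  min (sawtooth s b k (y j)) (cubeDist y)

section laminate

variable {N : ℕ} [Nonempty (Fin N)] (j : Fin N) (s b : ℝ) (k : ℕ)

lemma exists_lipschitzWith_laminate : ∃ K, LipschitzWith K (laminate j s b k) := by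
  have h1 : ∃ K, LipschitzWith K fun y : Fin N → ℝ => sawtooth s b k (y j) := by
    obtain ⟨K, hK⟩ := exists_lipschitzWith_finset_sup' (E := Fin N → ℝ)
      (s := Finset.range (k + 1)) ⟨0, by simp⟩ (u := fun p y =>
        min ((1 - b) * s * (y j - p / (k + 1))) (b * s * ((p + 1) / (k + 1) - y j)))
      fun p _ => by
        obtain ⟨K, hK⟩ := exists_lipschitzWith_affine (((1 - b) * s) •
          ContinuousLinearMap.proj (R := ℝ) (φ := fun _ : Fin N => ℝ) j)
          (-((1 - b) * s * (p / (k + 1))))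
        obtain ⟨L, hL⟩ := exists_lipschitzWith_affine ((-(b * s)) •
          ContinuousLinearMap.proj (R := ℝ) (φ := fun _ : Fin N => ℝ) j)
          (b * s * ((p + 1) / (k + 1)))
        refine ⟨max K L, ?_⟩
        convert hK.min hL using 3 <;> first | rfl | (simp; ring)
    exact ⟨_, (LipschitzWith.const (0 : ℝ)).max hK⟩
  have h2 : ∃ K, LipschitzWith K (cubeDist (N := N)) := by
    refine exists_lipschitzWith_finset_inf' (E := Fin N → ℝ) (s := Finset.univ) Finset.univ_nonempty
      (u := fun l y => min (y l) (1 - y l)) fun l _ => ?_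
    obtain ⟨K, hK⟩ := exists_lipschitzWith_affine
      (ContinuousLinearMap.proj (R := ℝ) (φ := fun _ : Fin N => ℝ) l) 0
    obtain ⟨L, hL⟩ := exists_lipschitzWith_affine
      (-ContinuousLinearMap.proj (R := ℝ) (φ := fun _ : Fin N => ℝ) l) 1
    refine ⟨max K L, ?_⟩
    convert hK.min hL using 3 <;> first | rfl | (simp <;> ring)
  obtain ⟨K, hK⟩ := h1
  obtain ⟨L, hL⟩ := h2
  exact ⟨_, hK.min hL⟩

lemma piecewiseAffine_laminate : PiecewiseAffine (laminateSlopes j s b) (laminate j s b k) := by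
  have h0 : PiecewiseAffine (laminateSlopes j s b) fun _ => (0 : ℝ) := by
    convert (PiecewiseAffine.affine (N := N) 0 0).mono (G := laminateSlopes j s b) ?_ using 2
    · simp
    · simp [laminateSlopes]
  refine PiecewiseAffine.inf (h0.sup (PiecewiseAffine.finset_sup' _ fun p _ => ?_))
    (PiecewiseAffine.finset_inf' _ fun l _ => ?_)
  · refine PiecewiseAffine.inf ?_ ?_
    · convert (PiecewiseAffine.affine (((1 - b) * s) • ContinuousLinearMap.proj (R := ℝ)
        (φ := fun _ : Fin N => ℝ) j) (-((1 - b) * s * (p / (k + 1))))).mono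
          (G := laminateSlopes j s b) ?_ using 2
      · simp
        ring
      · simp [laminateSlopes]
    · convert (PiecewiseAffine.affine ((-(b * s)) • ContinuousLinearMap.proj (R := ℝ)
        (φ := fun _ : Fin N => ℝ) j) (b * s * ((p + 1) / (k + 1)))).mono
          (G := laminateSlopes j s b) ?_ using 2
      · simp
        ring
      · simp [laminateSlopes]
  · refine PiecewiseAffine.inf ?_ ?_
    · convert (PiecewiseAffine.affine (ContinuousLinearMap.proj (R := ℝ)
        (φ := fun _ : Fin N => ℝ) l) 0).mono (G := laminateSlopes j s b) ?_ using 2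
      · simp
      · simp [laminateSlopes]
    · convert (PiecewiseAffine.affine (-ContinuousLinearMap.proj (R := ℝ)
        (φ := fun _ : Fin N => ℝ) l) 1).mono (G := laminateSlopes j s b) ?_ using 2
      · simp
        ring
      · simp [laminateSlopes]

variable {j s b k} {m : ℕ}

lemma grad_laminate_rise (hs : 0 < s) (hb : 0 < b) (hb1 : b < 1) (i : Fin m) {y : Fin N → ℝ}
    {p : ℕ} (hp : p ≤ k) (hy : s / (k + 1) < cubeDist y)
    (h : y j ∈ Ioo ((p : ℝ) / (k + 1)) ((p + b) / (k + 1))) :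
    grad (fun w => Pi.single i (laminate j s b k w)) y =
      ((1 - b) * s) • (Pi.single i (Pi.single j 1) : Fin m → Fin N → ℝ) := by
  have hk : (0 : ℝ) < k + 1 := by positivity
  refine grad_single (e := p / (k + 1)) i j ?_
  have h1 : ∀ᶠ w : Fin N → ℝ in nhds y, w j ∈ Ioo ((p : ℝ) / (k + 1)) ((p + b) / (k + 1)) :=
    (continuous_apply j).continuousAt.eventually (Ioo_mem_nhds h.1 h.2)
  filter_upwards [h1, continuous_cubeDist.continuousAt.eventually_const_lt hy] with w hw hw'
  have hle := sawtooth_le hs hb hb1 hp hw.1.le (hw.2.le.trans (by gcongr))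
  rw [laminate, min_eq_left (hle.trans hw'.le),
    sawtooth_eq_rise hs hb hb1 hp hw.1.le hw.2.le]

lemma grad_laminate_fall (hs : 0 < s) (hb : 0 < b) (hb1 : b < 1) (i : Fin m) {y : Fin N → ℝ}
    {p : ℕ} (hp : p ≤ k) (hy : s / (k + 1) < cubeDist y)
    (h : y j ∈ Ioo (((p : ℝ) + b) / (k + 1)) ((p + 1) / (k + 1))) :
    grad (fun w => Pi.single i (laminate j s b k w)) y =
      (-(b * s)) • (Pi.single i (Pi.single j 1) : Fin m → Fin N → ℝ) := by
  have hk : (0 : ℝ) < k + 1 := by positivity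
  refine grad_single (e := (p + 1) / (k + 1)) i j ?_
  have h1 : ∀ᶠ w : Fin N → ℝ in nhds y, w j ∈ Ioo (((p : ℝ) + b) / (k + 1)) ((p + 1) / (k + 1)) :=
    (continuous_apply j).continuousAt.eventually (Ioo_mem_nhds h.1 h.2)
  filter_upwards [h1, continuous_cubeDist.continuousAt.eventually_const_lt hy] with w hw hw'
  have hle := sawtooth_le hs hb hb1 hp (le_trans (by gcongr; linarith) hw.1.le) hw.2.le
  rw [laminate, min_eq_left (hle.trans hw'.le),
    sawtooth_eq_fall hs hb hb1 hp hw.1.le hw.2.le]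
  ring

end laminate

lemma ae_exists_mem_teeth {N : ℕ} (j : Fin N) (b : ℝ) (k : ℕ) :
    ∀ᵐ y : Fin N → ℝ, y j ∈ Ioo (0 : ℝ) 1 → ∃ p ≤ k,
      y j ∈ Ioo ((p : ℝ) / (k + 1)) ((p + b) / (k + 1)) ∨
      y j ∈ Ioo (((p : ℝ) + b) / (k + 1)) ((p + 1) / (k + 1)) := by
  have hk : (0 : ℝ) < k + 1 := by positivity
  have hc : (Set.range (fun p : ℕ => (p : ℝ) / (k + 1)) ∪
      Set.range (fun p : ℕ => ((p : ℝ) + b) / (k + 1))).Countable :=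
    (countable_range _).union (countable_range _)
  have h0 := (Measure.quasiMeasurePreserving_eval
    (μ := fun _ : Fin N => (volume : Measure ℝ)) j).ae (hc.ae_notMem volume)
  filter_upwards [h0] with y hy h
  simp only [mem_union, Set.mem_range, not_or, not_exists] at hy
  have h1 : 0 ≤ y j * (k + 1) := mul_nonneg h.1.le hk.le
  refine ⟨⌊y j * (k + 1)⌋₊, ?_, ?_⟩
  · have := (Nat.floor_lt h1).2 (show y j * (k + 1) < (k + 1 : ℕ) by push_cast; nlinarith [h.2])
    omega
  · set p := ⌊y j * (k + 1)⌋₊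
    have h2 : (p : ℝ) ≤ y j * (k + 1) := Nat.floor_le h1
    have h3 : y j * (k + 1) < p + 1 := Nat.lt_floor_add_one _
    have h4 : (p : ℝ) / (k + 1) < y j := lt_of_le_of_ne ((div_le_iff₀ hk).2 h2) (hy.1 p)
    have h5 : y j < (p + 1) / (k + 1) := (lt_div_iff₀ hk).2 h3
    rcases lt_or_gt_of_ne (hy.2 p) with h6 | h6
    · exact Or.inr ⟨h6, h5⟩
    · exact Or.inl ⟨h4, h6⟩

lemma lintegral_le_of_ae_cover {α : Type*} [MeasurableSpace α] {μ : Measure α} {g : α → ℝ≥0∞}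
    {A B D : Set α} {a p q : ℝ≥0∞} (hA : MeasurableSet A) (hB : MeasurableSet B)
    (hD : MeasurableSet D)
    (h : ∀ᵐ y ∂μ, (y ∈ A ∧ g y ≤ a) ∨ (y ∈ B ∧ g y ≤ p) ∨ (y ∈ D ∧ g y ≤ q)) :
    ∫⁻ y, g y ∂μ ≤ a * μ A + p * μ B + q * μ D := by
  calc ∫⁻ y, g y ∂μ
      ≤ ∫⁻ y, A.indicator (fun _ => a) y + B.indicator (fun _ => p) y +
          D.indicator (fun _ => q) y ∂μ := by
        refine lintegral_mono_ae ?_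
        filter_upwards [h] with y hy
        rcases hy with ⟨h1, h2⟩ | ⟨h1, h2⟩ | ⟨h1, h2⟩
        · rw [indicator_of_mem h1, add_assoc]
          exact h2.trans le_self_add
        · rw [indicator_of_mem h1]
          exact h2.trans (le_add_self.trans le_self_add)
        · rw [indicator_of_mem h1]
          exact h2.trans le_add_self
    _ = a * μ A + p * μ B + q * μ D := by
        rw [lintegral_add_right _ (measurable_const.indicator hD),
          lintegral_add_right _ (measurable_const.indicator hB), lintegral_indicator_const hA,
          lintegral_indicator_const hB, lintegral_indicator_const hD]

/-- The matrix with a single nonzero entry `1` at `(i, j)`. -/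
abbrev matUnit {N m : ℕ} (i : Fin m) (j : Fin N) : Fin m → Fin N → ℝ := Pi.single i (Pi.single j 1)

lemma Zfun_le_segment {N m : ℕ} {f : (Fin N → ℝ) → (Fin m → Fin N → ℝ) → ℝ≥0∞}
    {x : Fin N → ℝ} (hfin : ∀ ξ, Zfun f x ξ ≠ ⊤) (ξ : Fin m → Fin N → ℝ) (i : Fin m) (j : Fin N)
    {s b : ℝ} (hs : 0 < s) (hb : 0 < b) (hb1 : b < 1) :
    Zfun f x ξ ≤
      ENNReal.ofReal b * Zfun f x (ξ + ((1 - b) * s) • matUnit i j) +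
      ENNReal.ofReal (1 - b) * Zfun f x (ξ + (-(b * s)) • matUnit i j) := by
  have : Nonempty (Fin N) := ⟨j⟩
  set P := Zfun f x (ξ + ((1 - b) * s) • matUnit i j)
  set Q := Zfun f x (ξ + (-(b * s)) • matUnit i j)
  have hF : (PiecewiseAffine.rowMatrices (m := m) fun _ => laminateSlopes j s b).Finite :=
    PiecewiseAffine.finite_rowMatrices fun _ => finite_laminateSlopes j s b
  set C : ℝ≥0∞ := ∑ η ∈ hF.toFinset, Zfun f x (ξ + η)
  have hC : C ≠ ⊤ := (ENNReal.sum_lt_top.2 fun η _ => (hfin _).lt_top).ne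
  have key : ∀ k : ℕ, Zfun f x ξ ≤ C * (N * (2 * ENNReal.ofReal (s / (k + 1)))) +
      P * ENNReal.ofReal b + Q * ENNReal.ofReal (1 - b) := by
    intro k
    set u : (Fin N → ℝ) → Fin m → ℝ := fun w => Pi.single i (laminate j s b k w)
    have huF : ∀ᵐ y, ∃ η ∈ PiecewiseAffine.rowMatrices (m := m) fun _ => laminateSlopes j s b,
        ∀ᶠ w in nhds y, grad u w = η := by
      refine PiecewiseAffine.ae_eventually_grad fun i' => ?_
      by_cases hi : i' = i
      · subst hi
        simpa [u] using piecewiseAffine_laminate j s b k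
      · convert (PiecewiseAffine.affine (N := N) 0 0).mono (G := laminateSlopes j s b) ?_ using 2
        · simp [u, hi]
        · simp [laminateSlopes]
    have hu : LipZero (unitCube N) u := by
      refine ⟨?_, fun y hy => ?_⟩
      · obtain ⟨K, hK⟩ := exists_lipschitzWith_laminate j s b k
        exact ⟨_, (ContinuousLinearMap.single ℝ (fun _ : Fin m => ℝ) i).lipschitz.comp hK⟩
      · simp only [u, laminate, cubeDist_eq_zero hy, min_eq_right sawtooth_nonneg, Pi.single_zero]
    refine (Zfun_le_lintegral_of_ae_eventually hfin ξ hF hu huF).trans ?_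
    set A := {y ∈ unitCube N | cubeDist y ≤ s / (k + 1)} with hA
    set B := {y ∈ unitCube N | ∃ p ≤ k,
      y j ∈ Ioo (((p : ℝ) + 0) / (k + 1)) ((p + b) / (k + 1))} with hB
    set D := {y ∈ unitCube N | ∃ p ≤ k,
      y j ∈ Ioo (((p : ℝ) + b) / (k + 1)) ((p + 1) / (k + 1))} with hD
    have hmeas : ∀ c e : ℝ, MeasurableSet {y ∈ unitCube N | ∃ p ≤ k,
        y j ∈ Ioo (((p : ℝ) + c) / (k + 1)) ((p + e) / (k + 1))} := by
      intro c e
      have : {y ∈ unitCube N | ∃ p ≤ k, y j ∈ Ioo (((p : ℝ) + c) / (k + 1)) ((p + e) / (k + 1))} =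
          unitCube N ∩
            ⋃ p ≤ k, (fun y => y j) ⁻¹' Ioo (((p : ℝ) + c) / (k + 1)) ((p + e) / (k + 1)) := by
        ext y
        simp only [mem_ofPred_eq, mem_inter_iff, mem_iUnion, mem_preimage, exists_prop]
      rw [this]
      exact ((isOpen_unitCube N).inter
        (isOpen_biUnion fun p _ => isOpen_Ioo.preimage (continuous_apply j))).measurableSet
    have hAm : MeasurableSet A := (isOpen_unitCube N).measurableSet.inter
      (isClosed_le continuous_cubeDist continuous_const).measurableSet
    have hcover : ∀ᵐ y ∂volume.restrict (unitCube N),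
        (y ∈ A ∧ Zfun f x (ξ + grad u y) ≤ C) ∨ (y ∈ B ∧ Zfun f x (ξ + grad u y) ≤ P) ∨
        (y ∈ D ∧ Zfun f x (ξ + grad u y) ≤ Q) := by
      filter_upwards [ae_restrict_mem (isOpen_unitCube N).measurableSet, ae_restrict_of_ae huF,
        ae_restrict_of_ae (ae_exists_mem_teeth j b k)] with y hy ⟨η, hη, hev⟩ hteeth
      by_cases hyA : cubeDist y ≤ s / (k + 1)
      · refine Or.inl ⟨⟨hy, hyA⟩, ?_⟩
        rw [hev.self_of_nhds]
        exact Finset.single_le_sum (f := fun η => Zfun f x (ξ + η)) (fun _ _ => zero_le)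
          (hF.mem_toFinset.2 hη)
      · rw [not_le] at hyA
        obtain ⟨p, hp, h | h⟩ := hteeth (hy j (mem_univ j))
        · refine Or.inr (Or.inl ⟨⟨hy, p, hp, by simpa using h⟩, ?_⟩)
          rw [grad_laminate_rise hs hb hb1 i hp hyA h]
        · refine Or.inr (Or.inr ⟨⟨hy, p, hp, h⟩, ?_⟩)
          rw [grad_laminate_fall hs hb hb1 i hp hyA h]
    have hrest : ∀ S : Set (Fin N → ℝ), volume.restrict (unitCube N) S ≤ volume S :=
      fun S => Measure.restrict_apply_le _ _
    refine (lintegral_le_of_ae_cover hAm (hmeas 0 b) (hmeas b 1) hcover).trans ?_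
    gcongr
    · exact (hrest _).trans (volume_cubeDist_le _)
    · exact (hrest _).trans ((volume_teeth_le j k).trans (by simp))
    · exact (hrest _).trans (volume_teeth_le j k)
  have hlim : Tendsto (fun k : ℕ => C * (N * (2 * ENNReal.ofReal (s / (k + 1)))) +
      P * ENNReal.ofReal b + Q * ENNReal.ofReal (1 - b)) atTop
      (nhds (C * (N * (2 * ENNReal.ofReal 0)) + P * ENNReal.ofReal b +
        Q * ENNReal.ofReal (1 - b))) := by
    have h1 : Tendsto (fun k : ℕ => s / ((k : ℝ) + 1)) atTop (nhds 0) :=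
      tendsto_const_nhds.div_atTop (tendsto_natCast_atTop_atTop.atTop_add tendsto_const_nhds)
    refine Tendsto.add (Tendsto.add ?_ tendsto_const_nhds) tendsto_const_nhds
    refine ENNReal.Tendsto.const_mul ?_ (Or.inr hC)
    refine ENNReal.Tendsto.const_mul ?_ (Or.inr (by simp))
    refine ENNReal.Tendsto.const_mul ?_ (Or.inr (by simp))
    exact (ENNReal.continuous_ofReal.tendsto 0).comp h1
  have := ge_of_tendsto' hlim key
  simpa [mul_comm] using this

/-! ### Continuity of separately convex functions -/

lemma ConvexOn.abs_sub_le_of_bounds {g : ℝ → ℝ} (hg : ConvexOn ℝ univ g) {M v w : ℝ}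
    (h0 : ∀ t, 0 ≤ g t) (hv : g (v - 1) ≤ M)
    (hw : g (w + 1) ≤ M) (hvw : v < w) : |g w - g v| ≤ M * (w - v) := by
  have h1 := hg.slope_mono_adjacent (mem_univ v) (mem_univ (w + 1)) hvw (by linarith)
  have h2 := hg.slope_mono_adjacent (mem_univ (v - 1)) (mem_univ w) (by linarith) hvw
  have hpos : 0 < w - v := by linarith
  have e1 : w + 1 - w = 1 := by ring
  have e2 : v - (v - 1) = 1 := by ring
  rw [e1, div_one] at h1
  rw [e2, div_one] at h2
  have h3 := (div_le_iff₀ hpos).1 (h1.trans (by linarith [h0 w] : g (w + 1) - g w ≤ M))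
  have h4 := (le_div_iff₀ hpos).1 ((by linarith [h0 v] : -M ≤ g v - g (v - 1)).trans h2)
  exact abs_le.2 ⟨by linarith, h3⟩

lemma ConvexOn.abs_sub_le_of_forall_abs_le {g : ℝ → ℝ} (hg : ConvexOn ℝ univ g) {M c t : ℝ}
    (h0 : ∀ t, 0 ≤ g t) (hM : ∀ t, |t - c| ≤ 2 → g t ≤ M) (ht : |t - c| ≤ 1) :
    |g t - g c| ≤ M * |t - c| := by
  obtain ⟨h1, h2⟩ := abs_le.1 ht
  rcases lt_trichotomy t c with h | rfl | h
  · rw [abs_sub_comm, abs_sub_comm t]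
    rw [abs_of_pos (by linarith : 0 < c - t)]
    exact hg.abs_sub_le_of_bounds h0 (hM _ (abs_le.2 ⟨by linarith, by linarith⟩))
      (hM _ (abs_le.2 ⟨by linarith, by linarith⟩)) h
  · simp
  · rw [abs_of_pos (by linarith : 0 < t - c)]
    exact hg.abs_sub_le_of_bounds h0 (hM _ (abs_le.2 ⟨by linarith, by linarith⟩))
      (hM _ (abs_le.2 ⟨by linarith, by linarith⟩)) h

section SeparatelyConvex

variable {ι : Type*} [DecidableEq ι] {h : (ι → ℝ) → ℝ}

lemma exists_bound_of_separatelyConvex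
    (hc : ∀ x i, ConvexOn ℝ univ fun t => h (Function.update x i t)) (r : ℝ)
    (s : Finset ι) (x : ι → ℝ) :
    ∃ M, ∀ w, (∀ i ∈ s, |w i - x i| ≤ r) → (∀ i ∉ s, w i = x i) → h w ≤ M := by
  induction s using Finset.induction_on generalizing x with
  | empty =>
    refine ⟨h x, fun w _ hw => ?_⟩
    rw [show w = x from funext fun i => hw i (Finset.notMem_empty i)]
  | insert a s ha ih =>
    obtain ⟨M₁, h₁⟩ := ih (Function.update x a (x a - r))
    obtain ⟨M₂, h₂⟩ := ih (Function.update x a (x a + r))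
    refine ⟨max M₁ M₂, fun w hw hw' => ?_⟩
    have hwa := abs_le.1 (hw a (Finset.mem_insert_self a s))
    have h3 := (hc w a).le_max_of_mem_Icc (mem_univ (x a - r)) (mem_univ (x a + r))
      (⟨by linarith, by linarith⟩ : w a ∈ Icc (x a - r) (x a + r))
    rw [Function.update_eq_self] at h3
    have key : ∀ c : ℝ, (∀ i ∈ s, |Function.update w a c i - Function.update x a c i| ≤ r) ∧
        ∀ i ∉ s, Function.update w a c i = Function.update x a c i := by
      refine fun c => ⟨fun i hi => ?_, fun i hi => ?_⟩
      · have : i ≠ a := fun e => ha (e ▸ hi)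
        simpa [this] using hw i (Finset.mem_insert_of_mem hi)
      · by_cases e : i = a
        · subst e
          simp
        · simpa [e] using hw' i (by simp [e, hi])
    exact h3.trans (max_le_max (h₁ _ (key _).1 (key _).2) (h₂ _ (key _).1 (key _).2))

lemma continuous_of_separatelyConvex [Fintype ι]
    (hc : ∀ x i, ConvexOn ℝ univ fun t => h (Function.update x i t)) (h0 : ∀ x, 0 ≤ h x) :
    Continuous h := by
  refine continuous_iff_continuousAt.2 fun x => ?_
  obtain ⟨M, hM⟩ := exists_bound_of_separatelyConvex hc 2 Finset.univ x
  replace hM : ∀ w, (∀ i, |w i - x i| ≤ 2) → h w ≤ M := fun w hw =>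
    hM w (fun i _ => hw i) fun i hi => absurd (Finset.mem_univ i) hi
  have key : ∀ w, (∀ i, |w i - x i| ≤ 1) → ∀ s : Finset ι,
      |h (s.piecewise w x) - h x| ≤ ∑ i ∈ s, M * |w i - x i| := by
    intro w hw s
    induction s using Finset.induction_on with
    | empty => simp
    | insert a s ha ih =>
      rw [Finset.sum_insert ha, Finset.piecewise_insert]
      set z := s.piecewise w x with hz
      have hza : z a = x a := by simp [z, ha]
      have h1 := (hc z a).abs_sub_le_of_forall_abs_le (M := M) (c := x a) (t := w a)
        (fun t => h0 _) (fun t ht => hM _ fun i => ?_) (hw a)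
      · rw [← hza, Function.update_eq_self, hza] at h1
        exact (abs_sub_le _ (h z) _).trans (add_le_add h1 ih)
      · by_cases e : i = a
        · subst e
          simpa using ht
        · by_cases hi : i ∈ s
          · simpa [e, z, hi] using (hw i).trans one_le_two
          · simp [e, z, hi]
  refine tendsto_iff_dist_tendsto_zero.2 ?_
  have hlim : Tendsto (fun w : ι → ℝ => ∑ i, M * |w i - x i|) (nhds x) (nhds 0) := by
    have : Continuous fun w : ι → ℝ => ∑ i, M * |w i - x i| := by fun_prop
    simpa using this.tendsto x
  refine squeeze_zero' (Eventually.of_forall fun _ => dist_nonneg) ?_ hlim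
  filter_upwards [Metric.ball_mem_nhds x one_pos] with w hw
  have := key w (fun i => by
    rw [← Real.dist_eq]
    exact (dist_le_pi_dist w x i).trans hw.le) Finset.univ
  rwa [Finset.piecewise_univ, ← Real.dist_eq] at this

end SeparatelyConvex

lemma continuous_Zfun {N m : ℕ} {f : (Fin N → ℝ) → (Fin m → Fin N → ℝ) → ℝ≥0∞}
    {x : Fin N → ℝ} (hfin : ∀ ξ, Zfun f x ξ ≠ ⊤) : Continuous (Zfun f x) := by
  let c : (Fin m × Fin N → ℝ) → Fin m → Fin N → ℝ := fun z i j => z (i, j)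
  have hc : Continuous fun z => (Zfun f x (c z)).toReal := by
    refine continuous_of_separatelyConvex (fun z p => ?_) fun _ => ENNReal.toReal_nonneg
    have hupd : ∀ t, c (Function.update z p t) =
        c (Function.update z p 0) + t • matUnit p.1 p.2 := by
      intro t
      ext i j
      by_cases hi : i = p.1
      · subst hi
        by_cases hj : j = p.2
        · subst hj
          simp [c]
        · simp [c, hj, Function.update_apply, Prod.ext_iff]
      · simp [c, hi, Function.update_apply, Prod.ext_iff]
    refine LinearOrder.convexOn_of_lt convex_univ fun v _ w _ hvw a b ha hb hab => ?_
    have h1 := Zfun_le_segment hfin (c (Function.update z p (a • v + b • w))) p.1 p.2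
      (sub_pos.2 hvw) hb (by linarith)
    have e1 : c (Function.update z p (a • v + b • w)) + ((1 - b) * (w - v)) • matUnit p.1 p.2 =
        c (Function.update z p w) := by
      rw [hupd, hupd w, add_assoc, ← add_smul]
      congr 2
      simp only [smul_eq_mul, ← hab]
      linear_combination w * hab
    have e2 : c (Function.update z p (a • v + b • w)) + (-(b * (w - v))) • matUnit p.1 p.2 =
        c (Function.update z p v) := by
      rw [hupd, hupd v, add_assoc, ← add_smul]
      congr 2
      simp only [smul_eq_mul]
      linear_combination v * hab
    rw [e1, e2] at h1
    have h2 := ENNReal.toReal_mono (by simp [ENNReal.mul_eq_top, hfin]) h1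
    rw [ENNReal.toReal_add (by simp [ENNReal.mul_eq_top, hfin])
      (by simp [ENNReal.mul_eq_top, hfin]), ENNReal.toReal_mul, ENNReal.toReal_mul,
      ENNReal.toReal_ofReal hb.le, ENNReal.toReal_ofReal (by linarith),
      show 1 - b = a by linarith] at h2
    simp only [smul_eq_mul] at h2 ⊢
    linarith
  have h1 : Continuous fun (ξ : Fin m → Fin N → ℝ) (p : Fin m × Fin N) => ξ p.1 p.2 :=
    continuous_pi fun p => continuous_apply_apply p.1 p.2
  have h2 : Continuous fun ξ : Fin m → Fin N → ℝ => (Zfun f x ξ).toReal := by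
    simpa only [c, Function.comp_def] using hc.comp h1
  have h3 : Zfun f x = fun ξ => ENNReal.ofReal (Zfun f x ξ).toReal :=
    funext fun ξ => (ENNReal.ofReal_toReal (hfin ξ)).symm
  rw [h3]
  exact ENNReal.continuous_ofReal.comp h2

/-! ### Averaged lattice interpolation -/

/-- The average over `t ∈ [0, 1)` of `G` at the lattice point `⌊v + t (1, …, 1)⌋`. -/
noncomputable def floorAverage {N : ℕ} {E : Type*} [NormedAddCommGroup E] [NormedSpace ℝ E]
    (G : (Fin N → ℤ) → E) (v : Fin N → ℝ) : E :=
  ∫ t in Ico (0 : ℝ) 1, G fun i => ⌊v i + t⌋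

section floorAverage

variable {N : ℕ} {E : Type*} [NormedAddCommGroup E]

lemma integrableOn_comp_floor (G : (Fin N → ℤ) → E) (v : Fin N → ℝ) :
    IntegrableOn (fun t : ℝ => G fun i => ⌊v i + t⌋) (Ico 0 1) := by
  have hm : Measurable fun (t : ℝ) (i : Fin N) => ⌊v i + t⌋ :=
    measurable_pi_lambda _ fun i => Int.measurable_floor.comp (measurable_const_add _)
  have hfin : (Set.univ.pi fun i => Icc ⌊v i⌋ ⌊v i + 1⌋).Finite :=
    Set.Finite.pi fun i => finite_Icc _ _
  obtain ⟨C, hC⟩ := (hfin.image fun p => ‖G p‖).bddAbove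
  have hG : StronglyMeasurable G := by
    exact StronglyMeasurable.of_discrete
  refine Measure.integrableOn_of_bounded (M := C) (by simp)
    (hG.comp_measurable hm).aestronglyMeasurable ?_
  filter_upwards [ae_restrict_mem measurableSet_Ico] with t ht
  refine hC ⟨_, fun i _ => ⟨Int.floor_le_floor (by linarith [ht.1]),
    Int.floor_le_floor (by linarith [ht.2])⟩, rfl⟩

lemma integrableOn_floor (a : ℝ) : IntegrableOn (fun t : ℝ => (⌊a + t⌋ : ℝ)) (Ico 0 1) :=
  integrableOn_comp_floor (N := 1) (fun p => (p 0 : ℝ)) fun _ => a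

lemma setIntegral_floor (a : ℝ) : ∫ t in Ico (0 : ℝ) 1, (⌊a + t⌋ : ℝ) = a := by
  have h0 := Int.fract_nonneg a
  have h1 := Int.fract_lt_one a
  have ha := Int.floor_add_fract a
  have h : EqOn (fun t : ℝ => (⌊a + t⌋ : ℝ))
      (fun t => (⌊a⌋ : ℝ) + (Ico (1 - Int.fract a) 1).indicator (fun _ => 1) t) (Ico 0 1) := by
    intro t ht
    by_cases hta : 1 - Int.fract a ≤ t
    · have : ⌊a + t⌋ = ⌊a⌋ + 1 := by
        rw [Int.floor_eq_iff]
        push_cast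
        exact ⟨by linarith, by linarith [ht.2]⟩
      simp [this, indicator, hta, ht.2]
    · have : ⌊a + t⌋ = ⌊a⌋ := by
        rw [Int.floor_eq_iff]
        exact ⟨by linarith [ht.1], by linarith⟩
      simp [this, indicator, hta]
  have hsub : Ico (1 - Int.fract a) 1 ⊆ Ico (0 : ℝ) 1 := Ico_subset_Ico_left (by linarith)
  rw [setIntegral_congr_fun measurableSet_Ico h, integral_add (by simp)
    ((integrable_const _).indicator measurableSet_Ico), setIntegral_indicator measurableSet_Ico,
    inter_eq_self_of_subset_right hsub]
  simp [h0, ha]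

lemma setIntegral_abs_floor_sub_floor (a b : ℝ) :
    ∫ t in Ico (0 : ℝ) 1, |(⌊a + t⌋ : ℝ) - ⌊b + t⌋| = |a - b| := by
  wlog hab : b ≤ a generalizing a b
  · rw [abs_sub_comm a, ← this b a (le_of_not_ge hab)]
    simp only [abs_sub_comm]
  rw [abs_of_nonneg (sub_nonneg.2 hab)]
  have h : EqOn (fun t : ℝ => |(⌊a + t⌋ : ℝ) - ⌊b + t⌋|)
      (fun t => (⌊a + t⌋ : ℝ) - ⌊b + t⌋) (Ico 0 1) := fun t _ =>
    abs_of_nonneg (sub_nonneg.2 (by exact_mod_cast Int.floor_le_floor (by linarith)))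
  rw [setIntegral_congr_fun measurableSet_Ico h,
    integral_sub (integrableOn_floor a) (integrableOn_floor b), setIntegral_floor,
    setIntegral_floor]

variable [NormedSpace ℝ E]

lemma norm_floorAverage_sub_le (G : (Fin N → ℤ) → E) {c : ℝ} (v w : Fin N → ℝ)
    (h : ∀ t ∈ Ico (0 : ℝ) 1, ‖G (fun i => ⌊v i + t⌋) - G fun i => ⌊w i + t⌋‖ ≤
      c * ∑ i, |(⌊v i + t⌋ : ℝ) - ⌊w i + t⌋|) :
    ‖floorAverage G v - floorAverage G w‖ ≤ c * ∑ i, |v i - w i| := by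
  have hfloor : ∀ i, IntegrableOn (fun t : ℝ => |(⌊v i + t⌋ : ℝ) - ⌊w i + t⌋|) (Ico 0 1) :=
    fun i => ((integrableOn_floor _).sub (integrableOn_floor _)).abs
  rw [floorAverage, floorAverage,
    ← integral_sub (integrableOn_comp_floor G v) (integrableOn_comp_floor G w)]
  refine (norm_integral_le_of_norm_le
    ((integrable_finsetSum Finset.univ fun i _ => hfloor i).const_mul c) ?_).trans_eq ?_
  · filter_upwards [ae_restrict_mem measurableSet_Ico] with t ht using h t ht
  · rw [integral_const_mul, integral_finsetSum _ fun i _ => hfloor i]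
    simp only [setIntegral_abs_floor_sub_floor]

lemma floorAverage_clm [CompleteSpace E] (L : (Fin N → ℝ) →L[ℝ] E) (v : Fin N → ℝ) :
    floorAverage (fun p => L fun i => (p i : ℝ)) v = L v := by
  have hfloor : IntegrableOn (fun t : ℝ => fun i : Fin N => (⌊v i + t⌋ : ℝ)) (Ico 0 1) :=
    integrableOn_comp_floor (fun p i => (p i : ℝ)) v
  rw [floorAverage, L.integral_comp_comm hfloor]
  congr 1
  ext i
  rw [eval_integral fun i => integrableOn_floor _, setIntegral_floor]

lemma floorAverage_sub (G H : (Fin N → ℤ) → E) (v : Fin N → ℝ) :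
    floorAverage (fun p => G p - H p) v = floorAverage G v - floorAverage H v :=
  integral_sub (integrableOn_comp_floor G v) (integrableOn_comp_floor H v)

/-- The weight of the lattice point `p` in `floorAverage` at `v`. -/
noncomputable def floorWeight [Nonempty (Fin N)] (p : Fin N → ℤ) (v : Fin N → ℝ) : ℝ :=
  max 0 (min 1 (Finset.univ.inf' Finset.univ_nonempty fun i => (p i : ℝ) + 1 - v i) -
    max 0 (Finset.univ.sup' Finset.univ_nonempty fun i => (p i : ℝ) - v i))

lemma floorAverage_eq_sum [Nonempty (Fin N)] [CompleteSpace E] (G : (Fin N → ℤ) → E)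
    (s : Finset (Fin N → ℤ)) (hs : ∀ p ∉ s, G p = 0) (v : Fin N → ℝ) :
    floorAverage G v = ∑ p ∈ s, floorWeight p v • G p := by
  classical
  have hset : ∀ p : Fin N → ℤ, Ico (0 : ℝ) 1 ∩ {t | (fun i => ⌊v i + t⌋) = p} =
      Ico (max 0 (Finset.univ.sup' Finset.univ_nonempty fun i => (p i : ℝ) - v i))
        (min 1 (Finset.univ.inf' Finset.univ_nonempty fun i => (p i : ℝ) + 1 - v i)) := by
    intro p
    ext t
    simp only [mem_inter_iff, mem_Ico, mem_ofPred_eq, funext_iff, Int.floor_eq_iff, max_le_iff,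
      Finset.sup'_le_iff, lt_min_iff, Finset.lt_inf'_iff, Finset.mem_univ, true_imp_iff]
    constructor
    · rintro ⟨⟨h1, h2⟩, h3⟩
      exact ⟨⟨h1, fun i => by linarith [(h3 i).1]⟩, h2, fun i => by linarith [(h3 i).2]⟩
    · rintro ⟨⟨h1, h2⟩, h3, h4⟩
      exact ⟨⟨h1, h3⟩, fun i => ⟨by linarith [h2 i], by linarith [h4 i]⟩⟩
  have hsum : ∀ t : ℝ, (G fun i => ⌊v i + t⌋) =
      ∑ p ∈ s, {t | (fun i => ⌊v i + t⌋) = p}.indicator (fun _ => G p) t := by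
    intro t
    simp only [indicator, mem_ofPred_eq]
    rw [Finset.sum_ite_eq s (fun i => ⌊v i + t⌋) G]
    split_ifs with h
    · rfl
    · exact hs _ h
  have hmeas : ∀ p : Fin N → ℤ, MeasurableSet {t : ℝ | (fun i => ⌊v i + t⌋) = p} := fun p =>
    (measurable_pi_lambda _ fun i => Int.measurable_floor.comp (measurable_const_add _))
      (measurableSet_singleton p)
  rw [floorAverage]
  simp only [hsum]
  rw [integral_finsetSum _ fun p _ => (integrable_const _).indicator (hmeas p)]
  refine Finset.sum_congr rfl fun p _ => ?_
  rw [setIntegral_indicator (hmeas p), hset, setIntegral_const, floorWeight, Measure.real,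
    Real.volume_Ico, ENNReal.toReal_ofReal', max_comm]

lemma exists_piecewiseAffine_floorWeight [Nonempty (Fin N)] (p : Fin N → ℤ) (k : ℝ) :
    ∃ F : Set ((Fin N → ℝ) →L[ℝ] ℝ), F.Finite ∧
      PiecewiseAffine F fun y => floorWeight p (k • y) := by
  set F : Set ((Fin N → ℝ) →L[ℝ] ℝ) := insert 0 (Set.range fun i : Fin N =>
    (-k) • ContinuousLinearMap.proj (R := ℝ) (φ := fun _ : Fin N => ℝ) i)
  have hF : F.Finite := (finite_range _).insert 0
  have hconst : ∀ c : ℝ, ∀ G : Set ((Fin N → ℝ) →L[ℝ] ℝ), 0 ∈ G →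
      PiecewiseAffine G fun _ => c := by
    intro c G hG
    simpa using (PiecewiseAffine.affine (N := N) 0 c).mono (singleton_subset_iff.2 hG)
  have haff : ∀ (i : Fin N) (c : ℝ), PiecewiseAffine F fun y => c - k * y i := by
    intro i c
    convert (PiecewiseAffine.affine ((-k) • ContinuousLinearMap.proj (R := ℝ)
        (φ := fun _ : Fin N => ℝ) i) c).mono (G := F) ?_ using 2
    · simp
      ring
    · simp [F]
  have h1 := (hconst 1 F (mem_insert _ _)).inf (PiecewiseAffine.finset_inf' (F := F)
    (Finset.univ_nonempty (α := Fin N)) fun i _ => haff i ((p i : ℝ) + 1))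
  have h2 := (hconst 0 F (mem_insert _ _)).sup (PiecewiseAffine.finset_sup' (F := F)
    (Finset.univ_nonempty (α := Fin N)) fun i _ => haff i (p i : ℝ))
  have h3 := h1.add (h2.const_mul (-1))
  have h4 := (hconst 0 _ (mem_insert 0 _)).sup (h3.mono (subset_insert 0 _))
  refine ⟨insert 0 (Set.image2 (· + ·) F ((fun ℓ => (-1 : ℝ) • ℓ) '' F)),
    (Set.Finite.image2 _ hF (hF.image _)).insert 0, ?_⟩
  simpa only [floorWeight, Pi.smul_apply, smul_eq_mul, sub_eq_add_neg, neg_one_mul] using h4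

end floorAverage

/-- The interpolation of `φ` from the lattice `(k + 1)⁻¹ ℤ^N`. -/
noncomputable def latticeInterp {N m : ℕ} (φ : (Fin N → ℝ) → Fin m → ℝ) (k : ℕ)
    (y : Fin N → ℝ) : Fin m → ℝ :=
  floorAverage (fun p => φ fun i => (p i : ℝ) / (k + 1)) (((k : ℝ) + 1) • y)

section latticeInterp

variable {N m : ℕ} {φ : (Fin N → ℝ) → Fin m → ℝ} {K : NNReal}

lemma sum_abs_smul_sub_le (y z : Fin N → ℝ) {c : ℝ} (hc : 0 ≤ c) :
    ∑ i, |(c • y) i - (c • z) i| ≤ N * (c * ‖y - z‖) := by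
  calc ∑ i, |(c • y) i - (c • z) i| ≤ ∑ _i : Fin N, c * ‖y - z‖ := by
        refine Finset.sum_le_sum fun i _ => ?_
        rw [Pi.smul_apply, Pi.smul_apply, ← smul_sub, smul_eq_mul, abs_mul, abs_of_nonneg hc]
        exact mul_le_mul_of_nonneg_left (norm_le_pi_norm (y - z) i) hc
    _ = N * (c * ‖y - z‖) := by simp

lemma lipschitzWith_latticeInterp (hφ : LipschitzWith K φ) (k : ℕ) :
    LipschitzWith (N * K) (latticeInterp φ k) := by
  have hk : (0 : ℝ) < k + 1 := by positivity
  refine LipschitzWith.of_dist_le_mul fun y z => ?_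
  rw [dist_eq_norm, dist_eq_norm]
  refine (norm_floorAverage_sub_le (c := K / (k + 1)) _ _ _ fun t _ => ?_).trans
    ((mul_le_mul_of_nonneg_left (sum_abs_smul_sub_le y z hk.le) (by positivity)).trans_eq ?_)
  · refine (hφ.norm_sub_le _ _).trans ?_
    rw [div_mul_eq_mul_div, mul_div_assoc]
    refine mul_le_mul_of_nonneg_left ?_ K.2
    have hnn : 0 ≤ ∑ i, |((⌊(((k : ℝ) + 1) • y) i + t⌋ : ℤ) : ℝ) -
        ⌊(((k : ℝ) + 1) • z) i + t⌋| := Finset.sum_nonneg fun _ _ => abs_nonneg _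
    refine (pi_norm_le_iff_of_nonneg (by positivity)).2 fun i => ?_
    rw [Pi.sub_apply, ← sub_div, norm_div, Real.norm_eq_abs, Real.norm_of_nonneg hk.le]
    gcongr
    exact Finset.single_le_sum (f := fun i => |((⌊(((k : ℝ) + 1) • y) i + t⌋ : ℤ) : ℝ) -
        ⌊(((k : ℝ) + 1) • z) i + t⌋|) (fun _ _ => abs_nonneg _) (Finset.mem_univ i)
  · push_cast
    field_simp

lemma floor_smul_add_div_sub_abs_le (k : ℕ) (a : ℝ) {t : ℝ} (ht : t ∈ Ico (0 : ℝ) 1) :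
    |(⌊((k : ℝ) + 1) * a + t⌋ : ℝ) / (k + 1) - a| ≤ 1 / (k + 1) := by
  have hk : (0 : ℝ) < k + 1 := by positivity
  have h1 := Int.floor_le (((k : ℝ) + 1) * a + t)
  have h2 := Int.lt_floor_add_one (((k : ℝ) + 1) * a + t)
  rw [div_sub' hk.ne', abs_div, abs_of_pos hk]
  gcongr
  exact abs_le.2 ⟨by linarith [ht.1], by linarith [ht.2]⟩

lemma tendsto_fderiv_latticeInterp {y : Fin N → ℝ} (hφ : DifferentiableAt ℝ φ y)
    (hk : ∀ k, DifferentiableAt ℝ (latticeInterp φ k) y) :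
    Tendsto (fun k => fderiv ℝ (latticeInterp φ k) y) atTop (nhds (fderiv ℝ φ y)) := by
  set A := fderiv ℝ φ y
  rw [Metric.tendsto_atTop]
  intro ε' hε'
  obtain ⟨ε, hε, hεε'⟩ : ∃ ε : ℝ, 0 < ε ∧ 3 * ε * N < ε' := by
    refine ⟨ε' / (3 * (N + 1)), by positivity, ?_⟩
    rw [mul_div_assoc', div_mul_eq_mul_div, div_lt_iff₀ (by positivity)]
    nlinarith
  obtain ⟨δ, hδ, hball⟩ := Metric.eventually_nhds_iff.1 (hφ.hasFDerivAt.isLittleO.def hε)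
  obtain ⟨n, hn⟩ := exists_nat_gt (2 / δ)
  refine ⟨n, fun k hkn => ?_⟩
  have hk0 : (0 : ℝ) < k + 1 := by positivity
  have hkδ : 2 / ((k : ℝ) + 1) < δ := by
    rw [div_lt_iff₀ hδ] at hn
    rw [div_lt_iff₀ hk0]
    have : (n : ℝ) ≤ k := by exact_mod_cast hkn
    nlinarith
  set q : (Fin N → ℤ) → Fin m → ℝ := fun p =>
    φ (fun i => (p i : ℝ) / (k + 1)) - ((k : ℝ) + 1)⁻¹ • A fun i => (p i : ℝ)
  have hq : ∀ w, floorAverage q (((k : ℝ) + 1) • w) = latticeInterp φ k w - A w := by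
    intro w
    rw [floorAverage_sub]
    congr 1
    have := floorAverage_clm (((k : ℝ) + 1)⁻¹ • A) (((k : ℝ) + 1) • w)
    rw [smul_apply, map_smul, smul_smul, inv_mul_cancel₀ hk0.ne', one_smul] at this
    exact this
  have hpt : ∀ (w : Fin N → ℝ) (t : ℝ), t ∈ Ico (0 : ℝ) 1 →
      ‖(fun i => (⌊(((k : ℝ) + 1) • w) i + t⌋ : ℝ) / (k + 1)) - w‖ ≤ 1 / (k + 1) := fun w t ht =>
    (pi_norm_le_iff_of_nonneg (by positivity)).2 fun i => floor_smul_add_div_sub_abs_le k (w i) ht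
  have hqy : ∀ p : Fin N → ℤ, ∀ r : ℝ, r < δ → ‖(fun i => (p i : ℝ) / (k + 1)) - y‖ ≤ r →
      ‖q p - (φ y - A y)‖ ≤ ε * r := by
    intro p r hr hp
    have h1 := hball (y := fun i => (p i : ℝ) / (k + 1)) (by
      rw [dist_eq_norm]
      exact hp.trans_lt hr)
    have h2 : q p - (φ y - A y) = φ (fun i => (p i : ℝ) / (k + 1)) - φ y -
        A ((fun i => (p i : ℝ) / (k + 1)) - y) := by
      have : (fun i => (p i : ℝ) / ((k : ℝ) + 1)) = ((k : ℝ) + 1)⁻¹ • fun i => (p i : ℝ) := by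
        ext i
        simp [div_eq_inv_mul]
      simp only [q]
      rw [map_sub, this, map_smul]
      abel
    rw [h2]
    exact h1.trans (mul_le_mul_of_nonneg_left hp hε.le)
  have hder : HasFDerivAt (fun w => latticeInterp φ k w - A w)
      (fderiv ℝ (latticeInterp φ k) y - A) y := (hk k).hasFDerivAt.sub A.hasFDerivAt
  rw [dist_eq_norm]
  refine (hder.le_of_lip' (C := 3 * ε * N) (by positivity) ?_).trans_lt hεε'
  filter_upwards [Metric.ball_mem_nhds y (show 0 < 1 / ((k : ℝ) + 1) by positivity)] with w hw
  rw [Metric.mem_ball, dist_eq_norm] at hw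
  rw [← hq, ← hq]
  refine (norm_floorAverage_sub_le (c := 3 * ε / (k + 1)) q _ _ fun t ht => ?_).trans
    ((mul_le_mul_of_nonneg_left (sum_abs_smul_sub_le w y hk0.le) (by positivity)).trans_eq ?_)
  · by_cases heq : (fun i => ⌊(((k : ℝ) + 1) • w) i + t⌋) = fun i => ⌊(((k : ℝ) + 1) • y) i + t⌋
    · rw [heq, sub_self, norm_zero]
      exact mul_nonneg (by positivity) (Finset.sum_nonneg fun _ _ => abs_nonneg _)
    · have h1 : 1 ≤ ∑ i, |((⌊(((k : ℝ) + 1) • w) i + t⌋ : ℤ) : ℝ) -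
          ⌊(((k : ℝ) + 1) • y) i + t⌋| := by
        obtain ⟨i, hi⟩ := Function.ne_iff.1 heq
        refine le_trans ?_ (Finset.single_le_sum (fun _ _ => abs_nonneg _) (Finset.mem_univ i))
        exact_mod_cast Int.one_le_abs (sub_ne_zero.2 hi)
      have h2 := hqy (fun i => ⌊(((k : ℝ) + 1) • w) i + t⌋) (2 / (k + 1)) hkδ (by
        refine (norm_sub_le_norm_sub_add_norm_sub _ w _).trans ?_
        refine (add_le_add (hpt w t ht) hw.le).trans_eq ?_
        ring)
      have h3 := hqy (fun i => ⌊(((k : ℝ) + 1) • y) i + t⌋) (1 / (k + 1))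
        (lt_of_le_of_lt (by gcongr; norm_num) hkδ) (hpt y t ht)
      calc _ ≤ _ := norm_sub_le_norm_sub_add_norm_sub _ (φ y - A y) _
        _ ≤ ε * (2 / (k + 1)) + ε * (1 / (k + 1)) :=
          add_le_add h2 ((norm_sub_rev _ _).trans_le h3)
        _ = 3 * ε / (k + 1) * 1 := by ring
        _ ≤ _ := mul_le_mul_of_nonneg_left h1 (by positivity)
  · field_simp

lemma tendsto_grad_latticeInterp {y : Fin N → ℝ} (hφ : DifferentiableAt ℝ φ y)
    (hk : ∀ k, DifferentiableAt ℝ (latticeInterp φ k) y) :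
    Tendsto (fun k => grad (latticeInterp φ k) y) atTop (nhds (grad φ y)) := by
  have h := tendsto_fderiv_latticeInterp hφ hk
  refine tendsto_pi_nhds.2 fun i => tendsto_pi_nhds.2 fun j => ?_
  have hc : Continuous fun L : (Fin N → ℝ) →L[ℝ] (Fin m → ℝ) => L (Pi.single j 1) i := by
    fun_prop
  exact (hc.tendsto _).comp h

lemma latticeInterp_eq_zero (h0 : ∀ y ∉ unitCube N, φ y = 0) (k : ℕ) {y : Fin N → ℝ}
    (hy : y ∈ frontier (unitCube N)) : latticeInterp φ k y = 0 := by
  have hk : (0 : ℝ) < k + 1 := by positivity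
  rw [(isOpen_unitCube N).frontier_eq, closure_unitCube] at hy
  obtain ⟨h1, h2⟩ := hy
  simp only [unitCube, Set.mem_pi, mem_univ, true_imp_iff, not_forall, mem_Ioo] at h2
  obtain ⟨l, hl⟩ := h2
  refine setIntegral_eq_zero_of_forall_eq_zero fun t ht => h0 _ fun hmem => hl ?_
  have h3 := hmem l (mem_univ l)
  have h4 := h1 l (mem_univ l)
  simp only [mem_Ioo, Pi.smul_apply, smul_eq_mul] at h3
  have h5 : (0 : ℤ) < ⌊((k : ℝ) + 1) * y l + t⌋ := by
    have := (div_pos_iff_of_pos_right hk).1 h3.1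
    exact_mod_cast this
  have h6 : ⌊((k : ℝ) + 1) * y l + t⌋ < (k : ℤ) + 1 := by
    have := (div_lt_one hk).1 h3.2
    exact_mod_cast this
  have h7 := Int.floor_le (((k : ℝ) + 1) * y l + t)
  have h8 := Int.lt_floor_add_one (((k : ℝ) + 1) * y l + t)
  have h9 : (1 : ℝ) ≤ (⌊((k : ℝ) + 1) * y l + t⌋ : ℝ) := by exact_mod_cast h5
  have h10 : (⌊((k : ℝ) + 1) * y l + t⌋ : ℝ) + 1 ≤ k + 1 := by exact_mod_cast h6
  constructor
  · refine lt_of_le_of_ne h4.1 fun h => ?_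
    rw [← h] at h7 h9
    linarith [ht.2]
  · refine lt_of_le_of_ne h4.2 fun h => ?_
    rw [h] at h8 h10
    linarith [ht.1]

lemma exists_piecewiseAffine_latticeInterp [Nonempty (Fin N)] (h0 : ∀ y ∉ unitCube N, φ y = 0)
    (k : ℕ) (i : Fin m) : ∃ F : Set ((Fin N → ℝ) →L[ℝ] ℝ), F.Finite ∧
      PiecewiseAffine F fun y => latticeInterp φ k y i := by
  have hk : (0 : ℝ) < k + 1 := by positivity
  have hs : ∀ p ∉ Fintype.piFinset fun _ : Fin N => Finset.Icc (0 : ℤ) (k + 1),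
      (φ fun i => (p i : ℝ) / (k + 1)) = 0 := by
    refine fun p hp => h0 _ fun hmem => hp (Fintype.mem_piFinset.2 fun l => ?_)
    have h3 := hmem l (mem_univ l)
    have h5 := (div_pos_iff_of_pos_right hk).1 h3.1
    have h6 := (div_lt_one hk).1 h3.2
    exact Finset.mem_Icc.2 ⟨by exact_mod_cast h5.le, by exact_mod_cast h6.le⟩
  have he : (fun y => latticeInterp φ k y i) = fun y =>
      ∑ p ∈ Fintype.piFinset fun _ : Fin N => Finset.Icc (0 : ℤ) (k + 1),
        φ (fun i => (p i : ℝ) / (k + 1)) i * floorWeight p (((k : ℝ) + 1) • y) := by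
    ext y
    rw [latticeInterp, floorAverage_eq_sum _ _ hs, Finset.sum_apply]
    simp [mul_comm]
  rw [he]
  refine PiecewiseAffine.exists_finite_sum _ _ fun p _ => ?_
  obtain ⟨F, hF, h⟩ := exists_piecewiseAffine_floorWeight p ((k : ℝ) + 1)
  exact ⟨_, hF.image _, h.const_mul _⟩

end latticeInterp

lemma measurable_grad {N m : ℕ} (φ : (Fin N → ℝ) → Fin m → ℝ) : Measurable (grad φ) :=
  measurable_pi_lambda _ fun i => measurable_pi_lambda _ fun _ =>
    (measurable_pi_apply i).comp (measurable_fderiv_apply_const ℝ φ _)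

lemma LipschitzWith.norm_grad_le {N m : ℕ} {φ : (Fin N → ℝ) → Fin m → ℝ} {K : NNReal}
    (hφ : LipschitzWith K φ) (y : Fin N → ℝ) : ‖grad φ y‖ ≤ K := by
  refine (pi_norm_le_iff_of_nonneg K.2).2 fun i => (pi_norm_le_iff_of_nonneg K.2).2 fun j => ?_
  refine (norm_le_pi_norm (fderiv ℝ φ y (Pi.single j 1)) i).trans ?_
  refine ((fderiv ℝ φ y).le_opNorm _).trans ?_
  have h1 : ‖(Pi.single j 1 : Fin N → ℝ)‖ = 1 := by rw [Pi.norm_single, norm_one]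
  rw [h1, mul_one]
  exact norm_fderiv_le_of_lipschitz ℝ hφ

lemma Zfun_le_lintegral {N m : ℕ} {f : (Fin N → ℝ) → (Fin m → Fin N → ℝ) → ℝ≥0∞}
    {x : Fin N → ℝ} (hfin : ∀ ξ, Zfun f x ξ ≠ ⊤) (ξ : Fin m → Fin N → ℝ)
    {φ : (Fin N → ℝ) → Fin m → ℝ} (hφ : LipZero (unitCube N) φ) :
    Zfun f x ξ ≤ ∫⁻ y in unitCube N, Zfun f x (ξ + grad φ y) := by
  rcases isEmpty_or_nonempty (Fin N) with hN | hN
  · have : ∀ y, ξ + grad φ y = ξ := fun y => funext fun i => Subsingleton.elim _ _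
    simp [this, volume_unitCube]
  obtain ⟨⟨K, hK⟩, h0⟩ := hφ
  set φ₁ := (unitCube N).indicator φ with hφ₁
  have hK₁ : LipschitzWith K φ₁ := hK.indicator_of_eq_zero_frontier h0
  have hφ₁0 : ∀ y ∉ unitCube N, φ₁ y = 0 := fun y hy => indicator_of_notMem hy _
  have hgrad : ∀ y ∈ unitCube N, grad φ₁ y = grad φ y := by
    intro y hy
    have : φ₁ =ᶠ[nhds y] φ := by
      filter_upwards [(isOpen_unitCube N).mem_nhds hy] with w hw using indicator_of_mem hw _
    unfold grad
    rw [this.fderiv_eq]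
  have hcont : Continuous (Zfun f x) := continuous_Zfun hfin
  obtain ⟨M, hM⟩ : ∃ M : ℝ≥0∞, M ≠ ⊤ ∧ ∀ η : Fin m → Fin N → ℝ, ‖η‖ ≤ N * K →
      Zfun f x (ξ + η) ≤ M := by
    obtain ⟨η₀, -, h⟩ := (isCompact_closedBall (0 : Fin m → Fin N → ℝ) (N * K)).exists_isMaxOn
      ⟨0, Metric.mem_closedBall_self (by positivity)⟩ (f := fun η => Zfun f x (ξ + η)) (by fun_prop)
    exact ⟨_, hfin (ξ + η₀), fun η hη => h (mem_closedBall_zero_iff.2 hη)⟩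
  have hle : ∀ k, Zfun f x ξ ≤ ∫⁻ y in unitCube N, Zfun f x (ξ + grad (latticeInterp φ₁ k) y) := by
    intro k
    choose F hF hPA using exists_piecewiseAffine_latticeInterp hφ₁0 k
    exact Zfun_le_lintegral_of_ae_eventually hfin ξ (PiecewiseAffine.finite_rowMatrices hF)
      ⟨⟨_, lipschitzWith_latticeInterp hK₁ k⟩, fun y hy => latticeInterp_eq_zero hφ₁0 k hy⟩
      (PiecewiseAffine.ae_eventually_grad hPA)
  refine ge_of_tendsto' (tendsto_lintegral_of_dominated_convergence (fun _ => M)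
    (fun k => hcont.measurable.comp ((measurable_grad _).const_add ξ)) (fun k => ?_) ?_ ?_) hle
  · refine Eventually.of_forall fun y => hM.2 _ ?_
    simpa using (lipschitzWith_latticeInterp hK₁ k).norm_grad_le y
  · simpa [volume_unitCube] using hM.1
  · filter_upwards [ae_restrict_mem (isOpen_unitCube N).measurableSet,
      ae_restrict_of_ae hK₁.ae_differentiableAt, ae_restrict_of_ae (ae_all_iff.2 fun k =>
        (lipschitzWith_latticeInterp hK₁ k).ae_differentiableAt)] with y hy h1 h2
    rw [← hgrad y hy]
    exact (hcont.tendsto _).comp ((tendsto_grad_latticeInterp h1 h2).const_add ξ)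

/-! ### Novikov separation of countably many analytic sets -/

/-- A countable family of sets is separable if it has measurable supersets with empty
intersection. -/
def JointlySeparable {α : Type*} [MeasurableSpace α] (A : ℕ → Set α) : Prop :=
  ∃ B : ℕ → Set α, (∀ i, A i ⊆ B i) ∧ (∀ i, MeasurableSet (B i)) ∧ ⋂ i, B i = ∅

theorem JointlySeparable.mono {α : Type*} [MeasurableSpace α] {A A' : ℕ → Set α}
    (h : JointlySeparable A') (hA : ∀ i, A i ⊆ A' i) : JointlySeparable A := by
  obtain ⟨B, h1, h2, h3⟩ := h
  exact ⟨B, fun i => (hA i).trans (h1 i), h2, h3⟩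

/-- Splitting one member of a family into countably many pieces preserves separability. -/
theorem JointlySeparable.of_split {α : Type*} [MeasurableSpace α] {A : ℕ → Set α} (i : ℕ)
    (A' : ℕ → ℕ → Set α) (hi : A i ⊆ ⋃ c, A' c i) (hA : ∀ c j, j ≠ i → A j ⊆ A' c j)
    (h : ∀ c, JointlySeparable (A' c)) : JointlySeparable A := by
  choose B h1 h2 h3 using h
  refine ⟨fun j => if j = i then ⋃ c, B c i else ⋂ c, B c j, fun j => ?_, fun j => ?_, ?_⟩
  · by_cases hj : j = i
    · subst hj
      simpa using hi.trans (iUnion_mono fun c => h1 c j)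
    · simp only [hj, if_false]
      exact subset_iInter fun c => (hA c j hj).trans (h1 c j)
  · by_cases hj : j = i
    · simpa only [hj, if_true] using MeasurableSet.iUnion fun c => h2 c i
    · simpa only [hj, if_false] using MeasurableSet.iInter fun c => h2 c j
  · refine eq_empty_of_forall_notMem fun x hx => ?_
    rw [mem_iInter] at hx
    have hxi := hx i
    simp only [if_true, mem_iUnion] at hxi
    obtain ⟨c, hc⟩ := hxi
    have hmem : x ∈ ⋂ j, B c j := by
      refine mem_iInter.2 fun j => ?_
      by_cases hj : j = i
      · rw [hj]; exact hc
      · have hxj := hx j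
        simp only [hj, if_false, mem_iInter] at hxj
        exact hxj c
    rw [h3 c] at hmem
    exact hmem

/-- Infinite descent for predicates on finite initial segments of sequences. -/
theorem exists_seq_of_extend (P : ℕ → (ℕ → ℕ) → Prop)
    (hcongr : ∀ n p q, (∀ k < n, p k = q k) → P n p → P n q) (p₀ : ℕ → ℕ) (h0 : P 0 p₀)
    (hs : ∀ n p, P n p → ∃ c, P (n + 1) (Function.update p n c)) : ∃ p, ∀ n, P n p := by
  choose! c hc using hs
  let s : ℕ → ℕ → ℕ := fun n => Nat.rec p₀ (fun n p => Function.update p n (c n p)) n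
  have hsucc : ∀ n, s (n + 1) = Function.update (s n) n (c n (s n)) := fun n => rfl
  have hP : ∀ n, P n (s n) := by
    intro n
    induction n with
    | zero => exact h0
    | succ n ih => rw [hsucc]; exact hc n _ ih
  have hst : ∀ k n, k + 1 ≤ n → s n k = s (k + 1) k := by
    intro k
    apply Nat.le_induction
    · rfl
    · intro n hn ih
      rw [hsucc, Function.update_of_ne (by omega), ih]
  exact ⟨fun k => s (k + 1) k, fun n => hcongr n _ _ (fun k hk => hst k n hk) (hP n)⟩

theorem jointlySeparable_range {α : Type*} [TopologicalSpace α] [T2Space α] [MeasurableSpace α]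
    [OpensMeasurableSpace α] (g : ℕ → (ℕ → ℕ) → α) (hg : ∀ i, Continuous (g i))
    (h : ⋂ i, range (g i) = ∅) : JointlySeparable fun i => range (g i) := by
  by_contra hbad
  let S : ℕ → (ℕ → ℕ) → ℕ → Set (ℕ → ℕ) := fun n p i =>
    {x | ∀ j, Nat.pair i j < n → x j = p (Nat.pair i j)}
  obtain ⟨p, hp⟩ := exists_seq_of_extend
    (fun n p => ¬ JointlySeparable fun i => g i '' S n p i) (by
      intro n p q hpq hP
      have : S n q = S n p := by
        funext i
        ext x
        exact forall₂_congr fun j hj => by rw [hpq _ hj]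
      rwa [this]) (fun _ => 0) (by
      have : ∀ i, S 0 (fun _ => 0) i = univ := fun i =>
        eq_univ_of_forall fun x j hj => absurd hj (Nat.not_lt_zero _)
      simpa [this] using hbad) (by
      intro n p hP
      by_contra! hall
      refine hP (JointlySeparable.of_split (Nat.unpair n).1
        (fun c i => g i '' S (n + 1) (Function.update p n c) i) ?_ ?_ hall)
      · rintro _ ⟨x, hx, rfl⟩
        refine mem_iUnion.2 ⟨x (Nat.unpair n).2, x, fun j hj => ?_, rfl⟩
        rcases Nat.lt_succ_iff_lt_or_eq.1 hj with hj | hj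
        · rw [Function.update_of_ne hj.ne]
          exact hx j hj
        · have hj2 : j = (Nat.unpair n).2 := by rw [← hj, Nat.unpair_pair]
          rw [hj, Function.update_self, hj2]
      · intro c j hj
        refine image_mono fun x hx k hk => ?_
        have hne : Nat.pair j k ≠ n := fun he => hj (by rw [← he, Nat.unpair_pair])
        rw [Function.update_of_ne hne]
        exact hx k (by omega))
  let z : ℕ → ℕ → ℕ := fun i j => p (Nat.pair i j)
  have hcyl : ∀ i (U : Set α), IsOpen U → g i (z i) ∈ U → ∃ n₀, ∀ n ≥ n₀, g i '' S n p i ⊆ U := by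
    intro i U hU hz
    have hn : (g i) ⁻¹' U ∈ nhds (z i) := (hg i).continuousAt.preimage_mem_nhds (hU.mem_nhds hz)
    rw [nhds_pi, Filter.mem_pi] at hn
    obtain ⟨I, hI, t, ht, hsub⟩ := hn
    obtain ⟨b, hb⟩ := (hI.image fun j => Nat.pair i j).bddAbove
    refine ⟨b + 1, fun n hn => image_subset_iff.2 fun x hx => hsub fun j hj => ?_⟩
    rw [hx j ((hb (mem_image_of_mem _ hj)).trans_lt (by omega))]
    exact mem_of_mem_nhds (ht j)
  by_cases heq : ∀ i, g i (z i) = g 0 (z 0)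
  · have : g 0 (z 0) ∈ ⋂ i, range (g i) := mem_iInter.2 fun i => ⟨z i, heq i⟩
    rw [h] at this
    exact this
  · push Not at heq
    obtain ⟨i, hi⟩ := heq
    obtain ⟨U, V, hU, hV, hiU, h0V, hUV⟩ := t2_separation hi
    obtain ⟨n₁, h₁⟩ := hcyl i U hU hiU
    obtain ⟨n₂, h₂⟩ := hcyl 0 V hV h0V
    have hi0 : i ≠ 0 := fun h => hi (by rw [h])
    refine hp (max n₁ n₂) ⟨fun j => if j = i then U else if j = 0 then V else univ,
      fun j => ?_, fun j => ?_, ?_⟩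
    · dsimp only
      split_ifs with hj hj
      · subst hj; exact h₁ _ (le_max_left _ _)
      · subst hj; exact h₂ _ (le_max_right _ _)
      · exact subset_univ _
    · dsimp only
      split_ifs
      exacts [hU.measurableSet, hV.measurableSet, MeasurableSet.univ]
    · refine eq_empty_of_forall_notMem fun x hx => ?_
      rw [mem_iInter] at hx
      have h1 := hx i
      have h2 := hx 0
      simp only [if_true, hi0.symm, if_false] at h1 h2
      exact disjoint_left.1 hUV h1 h2

/-- **Novikov's separation theorem**. -/
theorem jointlySeparable_of_analyticSet {α : Type*} [TopologicalSpace α] [T2Space α]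
    [MeasurableSpace α] [OpensMeasurableSpace α] {A : ℕ → Set α} (hA : ∀ i, AnalyticSet (A i))
    (h : ⋂ i, A i = ∅) : JointlySeparable A := by
  by_cases hne : ∀ i, (A i).Nonempty
  · have hex : ∀ i, ∃ g : (ℕ → ℕ) → α, Continuous g ∧ range g = A i := fun i => by
      have := hA i
      rw [AnalyticSet] at this
      exact this.resolve_left (hne i).ne_empty
    choose g hg hgA using hex
    simpa only [hgA] using jointlySeparable_range g hg (by simpa only [hgA] using h)
  · push Not at hne
    obtain ⟨i, hi⟩ := hne
    refine ⟨fun j => if j = i then ∅ else univ, fun j => ?_, fun j => ?_, ?_⟩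
    · dsimp only
      split_ifs with hj
      · rw [hj, hi]
      · exact subset_univ _
    · dsimp only
      split_ifs
      exacts [MeasurableSet.empty, MeasurableSet.univ]
    · exact subset_empty_iff.1 ((iInter_subset _ i).trans (by simp))

/-- **Kunugui–Novikov theorem**: a Borel subset of a product whose sections are open is a
countable union of measurable rectangles with open second side. -/
theorem exists_eq_iUnion_prod_of_isOpen_section {X M : Type*} [TopologicalSpace X] [PolishSpace X]
    [MeasurableSpace X] [BorelSpace X] [TopologicalSpace M] [PolishSpace M] [MeasurableSpace M]
    [BorelSpace M] {C : Set (X × M)} (hC : MeasurableSet C)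
    (hopen : ∀ x, IsOpen {η | (x, η) ∈ C}) {U : ℕ → Set M} (hU : ∀ i, IsOpen (U i))
    (hbasis : ∀ η V, IsOpen V → η ∈ V → ∃ i, η ∈ U i ∧ U i ⊆ V) :
    ∃ D : ℕ → Set X, (∀ i, MeasurableSet (D i)) ∧ C = ⋃ i, D i ×ˢ U i := by
  have hUm : ∀ i, MeasurableSet (U i) := fun i => (hU i).measurableSet
  let T : ℕ → Set ((X × M) × M) := fun i =>
    {q | q.1 ∈ C ∧ ((q.2 ∈ U i ∧ (q.1.1, q.2) ∉ C) ∨ q.1.2 ∉ U i)}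
  have hT : ∀ i, MeasurableSet (T i) := fun i => by
    refine (measurable_fst hC).inter (((measurable_snd (hUm i)).inter ?_).union ?_)
    · exact ((measurable_fst.comp measurable_fst).prodMk measurable_snd) hC.compl
    · exact (measurable_snd.comp measurable_fst) (hUm i).compl
  let W : ℕ → Set X := fun i => Prod.fst '' ((Prod.snd ⁻¹' U i) \ C)
  have hW : ∀ i, AnalyticSet (W i) := fun i =>
    ((measurable_snd (hUm i)).diff hC).analyticSet_image measurable_fst
  have hTW : ∀ i p, p ∈ C → p ∉ Prod.fst '' T i → p.1 ∉ W i ∧ p.2 ∈ U i := by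
    intro i p hp hpT
    refine ⟨?_, ?_⟩
    · rintro ⟨q, hq, hqp⟩
      exact hpT ⟨(p, q.2), ⟨hp, Or.inl ⟨hq.1, by
        have : (p.1, q.2) = q := by rw [← hqp]
        rw [this]; exact hq.2⟩⟩, rfl⟩
    · by_contra hpU
      exact hpT ⟨(p, p.2), ⟨hp, Or.inr hpU⟩, rfl⟩
  obtain ⟨B, hB1, hB2, hB3⟩ := jointlySeparable_of_analyticSet
    (A := fun i => Prod.fst '' T i) (fun i => (hT i).analyticSet_image measurable_fst) (by
      refine eq_empty_of_forall_notMem fun p hp => ?_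
      rw [mem_iInter] at hp
      obtain ⟨q, hq, rfl⟩ := hp 0
      obtain ⟨i, hi, hiC⟩ := hbasis q.1.2 _ (hopen q.1.1) hq.1
      obtain ⟨r, hr, hrq⟩ := hp i
      rcases hr.2 with h | h
      · rw [hrq] at h
        exact h.2 (hiC h.1)
      · rw [hrq] at h
        exact h hi)
  have hsep : ∀ i, ∃ D, Prod.fst '' (C \ B i) ⊆ D ∧ Disjoint (W i) D ∧ MeasurableSet D := by
    intro i
    refine ((hC.diff (hB2 i)).analyticSet_image measurable_fst).measurablySeparable (hW i) ?_
    rw [disjoint_left]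
    rintro _ ⟨p, hp, rfl⟩
    exact (hTW i p hp.1 fun h => hp.2 (hB1 i h)).1
  choose D hD1 hD2 hD3 using hsep
  refine ⟨D, hD3, Subset.antisymm (fun p hp => ?_) (iUnion_subset fun i p hp => ?_)⟩
  · have : ∃ i, p ∉ B i := by
      by_contra! hall
      have : p ∈ ⋂ i, B i := mem_iInter.2 hall
      rw [hB3] at this
      exact this
    obtain ⟨i, hi⟩ := this
    exact mem_iUnion.2 ⟨i, hD1 i ⟨p, ⟨hp, hi⟩, rfl⟩, (hTW i p hp fun h => hi (hB1 i h)).2⟩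
  · by_contra hpC
    exact disjoint_left.1 (hD2 i) ⟨p, ⟨hp.2, hpC⟩, rfl⟩ hp.1

/-- A jointly measurable function which is lower semicontinuous in the second variable is a
countable supremum of products of a measurable and a continuous function. -/
theorem exists_eq_iSup_mul {X M : Type*} [TopologicalSpace X] [PolishSpace X] [MeasurableSpace X]
    [BorelSpace X] [MetricSpace M] [PolishSpace M] [MeasurableSpace M] [BorelSpace M]
    {f : X → M → ℝ≥0∞} (hf : Measurable (Function.uncurry f))
    (hl : ∀ x, LowerSemicontinuous (f x)) :
    ∃ (a : ℕ → X → NNReal) (θ : ℕ → M → ℝ≥0∞), (∀ j, Measurable (a j)) ∧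
      (∀ j, Continuous (θ j)) ∧ (∀ j η, θ j η ≤ 1) ∧ ∀ x η, f x η = ⨆ j, a j x * θ j η := by
  obtain ⟨U, hU, hbasis⟩ : ∃ U : ℕ → Set M, (∀ i, IsOpen (U i)) ∧
      ∀ η V, IsOpen V → η ∈ V → ∃ i, η ∈ U i ∧ U i ⊆ V := by
    obtain ⟨b, hbc, -, hb⟩ := TopologicalSpace.exists_countable_basis M
    rcases b.eq_empty_or_nonempty with rfl | hne
    · refine ⟨fun _ => univ, fun _ => isOpen_univ, fun η V hV hη => ?_⟩
      obtain ⟨_, h, -⟩ := hb.exists_subset_of_mem_open hη hV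
      exact h.elim
    · obtain ⟨U, rfl⟩ := hbc.exists_eq_range hne
      refine ⟨U, fun i => hb.isOpen (mem_range_self i), fun η V hV hη => ?_⟩
      obtain ⟨_, ⟨i, rfl⟩, h1, h2⟩ := hb.exists_subset_of_mem_open hη hV
      exact ⟨i, h1, h2⟩
  let c : ℕ → NNReal := TopologicalSpace.denseSeq NNReal
  have hrect : ∀ n, ∃ D : ℕ → Set X, (∀ i, MeasurableSet (D i)) ∧
      {p : X × M | (c n : ℝ≥0∞) < f p.1 p.2} = ⋃ i, D i ×ˢ U i := fun n =>
    exists_eq_iUnion_prod_of_isOpen_section (measurableSet_lt measurable_const hf)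
      (fun x => (hl x).isOpen_preimage (c n : ℝ≥0∞)) hU hbasis
  choose D hD hDU using hrect
  let θ : ℕ → ℕ → M → ℝ≥0∞ := fun i k η => min 1 (k * Metric.infEDist η (U i)ᶜ)
  let a : ℕ → ℕ → X → NNReal := fun n i => (D n i).indicator fun _ => c n
  let e : ℕ ≃ ℕ × ℕ × ℕ := (Denumerable.eqv (ℕ × ℕ × ℕ)).symm
  refine ⟨fun j => a (e j).1 (e j).2.1, fun j => θ (e j).2.1 (e j).2.2,
    fun j => measurable_const.indicator (hD _ _), fun j => ?_, fun j η => min_le_left _ _,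
    fun x η => ?_⟩
  · exact continuous_const.min
      ((ENNReal.continuous_const_mul (ENNReal.natCast_ne_top _)).comp Metric.continuous_infEDist)
  · rw [e.iSup_comp (g := fun t => (a t.1 t.2.1 x : ℝ≥0∞) * θ t.2.1 t.2.2 η)]
    apply le_antisymm
    · refine le_of_forall_lt fun r hr => ?_
      obtain ⟨s, hrs, hsf⟩ := exists_between hr
      have hst : s ≠ ⊤ := hsf.ne_top
      obtain ⟨n, hn1, hn2⟩ : ∃ n, r < c n ∧ (c n : ℝ≥0∞) < f x η := by
        have hop : IsOpen {t : NNReal | r < t ∧ (t : ℝ≥0∞) < f x η} :=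
          (isOpen_lt continuous_const ENNReal.continuous_coe).inter
            (isOpen_lt ENNReal.continuous_coe continuous_const)
        obtain ⟨n, hn⟩ := (TopologicalSpace.denseRange_denseSeq NNReal).exists_mem_open hop
          ⟨s.toNNReal, by
            rw [mem_ofPred_eq, ENNReal.coe_toNNReal hst]; exact ⟨hrs, hsf⟩⟩
        exact ⟨n, hn⟩
      have hmem : (x, η) ∈ ⋃ i, D n i ×ˢ U i := by
        rw [← hDU n]; exact hn2
      obtain ⟨i, hx, hη⟩ := mem_iUnion.1 hmem
      have hpos : Metric.infEDist η (U i)ᶜ ≠ 0 := by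
        intro h0
        have := Metric.mem_closure_iff_infEDist_zero.2 h0
        rw [(hU i).isClosed_compl.closure_eq] at this
        exact this hη
      obtain ⟨k, hk⟩ := ENNReal.exists_nat_mul_gt hpos ENNReal.one_ne_top
      refine hn1.trans_le (le_iSup_of_le (n, i, k) ?_)
      have h1 : a n i x = c n := indicator_of_mem hx _
      have h2 : θ i k η = 1 := min_eq_left hk.le
      simp only [h1, h2, mul_one, le_refl]
    · refine iSup_le fun ⟨n, i, k⟩ => ?_
      by_cases hx : x ∈ D n i
      · by_cases hη : η ∈ U i
        · have hmem : (x, η) ∈ {p : X × M | (c n : ℝ≥0∞) < f p.1 p.2} := by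
            rw [hDU n]; exact mem_iUnion.2 ⟨i, hx, hη⟩
          have h1 : a n i x = c n := indicator_of_mem hx _
          simp only [h1]
          calc (c n : ℝ≥0∞) * θ i k η ≤ c n * 1 := by gcongr; exact min_le_left _ _
            _ ≤ f x η := by rw [mul_one]; exact hmem.le
        · have h2 : θ i k η = 0 := by
            simp only [θ]
            rw [Metric.infEDist_zero_of_mem (show η ∈ (U i)ᶜ from hη)]
            simp
          simp only [h2, mul_zero, zero_le]
      · have h1 : a n i x = 0 := indicator_of_notMem hx _
        simp only [h1, ENNReal.coe_zero, zero_mul, zero_le]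

/-! ### Measurability in the parameter -/

/-- The maximum of the first `k` functions `a j • θ j`. -/
noncomputable def truncSup {M : Type*} (θ : ℕ → M → ℝ≥0∞) (k : ℕ) (a : ℕ → NNReal) (η : M) :
    ℝ≥0∞ := (Finset.range k).sup fun j => a j * θ j η

theorem continuous_truncSup {M : Type*} [TopologicalSpace M] {θ : ℕ → M → ℝ≥0∞}
    (hθ : ∀ j, Continuous (θ j)) (k : ℕ) (a : ℕ → NNReal) : Continuous (truncSup θ k a) := by
  exact Continuous.finset_sup_apply fun j _ =>
    (ENNReal.continuous_const_mul ENNReal.coe_ne_top).comp (hθ j)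

theorem truncSup_mono {M : Type*} (θ : ℕ → M → ℝ≥0∞) (a : ℕ → NNReal) (η : M) :
    Monotone fun k => truncSup θ k a η := fun _ _ h =>
  Finset.sup_mono (Finset.range_mono h)

theorem iSup_truncSup {M : Type*} (θ : ℕ → M → ℝ≥0∞) (a : ℕ → NNReal) (η : M) :
    ⨆ k, truncSup θ k a η = ⨆ j, a j * θ j η := by
  apply le_antisymm
  · exact iSup_le fun k => Finset.sup_le fun j _ => le_iSup (fun j => (a j : ℝ≥0∞) * θ j η) j
  · exact iSup_le fun j => le_iSup_of_le (j + 1)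
      (Finset.le_sup (f := fun j => (a j : ℝ≥0∞) * θ j η) (Finset.self_mem_range_succ j))

theorem upperSemicontinuous_lintegral_truncSup {N : ℕ} {M : Type*} {θ : ℕ → M → ℝ≥0∞}
    (hθ : ∀ j η, θ j η ≤ 1) (k : ℕ) (u : (Fin N → ℝ) → M) :
    UpperSemicontinuous fun a => ∫⁻ y in unitCube N, truncSup θ k a (u y) := by
  intro a r hr
  obtain ⟨δ, hδ, hδr⟩ : ∃ δ : NNReal, 0 < δ ∧
      ∫⁻ y in unitCube N, truncSup θ k a (u y) + δ < r := by
    obtain ⟨s, hs, hsr⟩ := ENNReal.lt_iff_exists_add_pos_lt.1 hr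
    refine ⟨s, hs, ?_⟩
    rwa [lintegral_add_right _ measurable_const, setLIntegral_const, volume_unitCube, mul_one]
  have hev : ∀ᶠ b : ℕ → NNReal in nhds a, ∀ j ∈ Finset.range k, b j < a j + δ := by
    rw [Finset.eventually_all]
    exact fun j _ => (continuous_apply j).continuousAt.eventually_lt continuousAt_const
      (lt_add_of_pos_right _ hδ)
  filter_upwards [hev] with b hb
  refine (lintegral_mono fun y => Finset.sup_le fun j hj => ?_).trans_lt hδr
  calc (b j : ℝ≥0∞) * θ j (u y) ≤ (a j + δ) * θ j (u y) := by
        gcongr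
        exact_mod_cast (hb j hj).le
    _ = a j * θ j (u y) + δ * θ j (u y) := add_mul _ _ _
    _ ≤ truncSup θ k a (u y) + δ := by
        gcongr
        · exact Finset.le_sup (f := fun j => (a j : ℝ≥0∞) * θ j (u y)) hj
        · exact mul_le_of_le_one_right' (hθ _ _)

theorem Zfun_le {N m : ℕ} (f : (Fin N → ℝ) → (Fin m → Fin N → ℝ) → ℝ≥0∞) (x : Fin N → ℝ)
    (ξ : Fin m → Fin N → ℝ) : Zfun f x ξ ≤ f x ξ := by
  refine iInf₂_le_of_le (fun _ => 0) ⟨⟨0, LipschitzWith.const 0⟩, fun _ _ => rfl⟩ ?_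
  have hgrad : ∀ y, ξ + grad (fun _ : Fin N → ℝ => (0 : Fin m → ℝ)) y = ξ := fun y => by
    ext i j
    simp [grad]
  simp [hgrad, volume_unitCube]

theorem Zfun_eq_iInf_iSup {N m : ℕ} {f : (Fin N → ℝ) → (Fin m → Fin N → ℝ) → ℝ≥0∞}
    {x : Fin N → ℝ} (hfin : ∀ ξ, Zfun f x ξ ≠ ⊤) {θ : ℕ → (Fin m → Fin N → ℝ) → ℝ≥0∞}
    (hθ : ∀ j, Continuous (θ j)) {a : ℕ → NNReal} (hfa : ∀ η, f x η = ⨆ j, a j * θ j η)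
    (ξ : Fin m → Fin N → ℝ) :
    Zfun f x ξ = ⨅ n : ℕ, ⨆ k, ⨅ φ : {φ : (Fin N → ℝ) → Fin m → ℝ //
      LipZero (unitCube N) φ ∧ LipschitzWith n φ},
        ∫⁻ y in unitCube N, truncSup θ k a (ξ + grad φ y) := by
  apply le_antisymm
  · refine le_iInf fun n => ENNReal.le_of_forall_pos_le_add fun ε hε _ => ?_
    obtain ⟨k, hk⟩ := (isCompact_closedBall ξ n).elim_directed_cover
      (fun k => {η | Zfun f x η < truncSup θ k a η + ε})
      (fun k => isOpen_lt (continuous_Zfun hfin)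
        ((continuous_truncSup hθ k a).add continuous_const))
      (fun η _ => by
        have hlt : Zfun f x η < (⨆ k, truncSup θ k a η) + ε := by
          rw [iSup_truncSup, ← hfa]
          exact (ENNReal.lt_add_right (hfin η) (ENNReal.coe_pos.2 hε).ne').trans_le
            (add_le_add_left (Zfun_le f x η) _)
        rw [ENNReal.iSup_add, lt_iSup_iff] at hlt
        exact mem_iUnion.2 hlt)
      (directed_of_isDirected_le fun i j hij η hη =>
        lt_of_lt_of_le hη (add_le_add_left (truncSup_mono θ a η hij) _))
    rw [ENNReal.iSup_add]
    refine le_iSup_of_le k ?_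
    rw [ENNReal.iInf_add]
    refine le_iInf fun φ => ?_
    calc Zfun f x ξ ≤ ∫⁻ y in unitCube N, Zfun f x (ξ + grad φ.1 y) :=
          Zfun_le_lintegral hfin ξ φ.2.1
      _ ≤ ∫⁻ y in unitCube N, (truncSup θ k a (ξ + grad φ.1 y) + ε) := by
          refine lintegral_mono fun y => (hk ?_).le
          rw [mem_closedBall_iff_norm, add_sub_cancel_left]
          exact_mod_cast φ.2.2.norm_grad_le y
      _ = _ := by
          rw [lintegral_add_right _ measurable_const, setLIntegral_const, volume_unitCube, mul_one]
  · refine le_iInf₂ fun φ hφ => ?_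
    obtain ⟨K, hK⟩ := hφ.1
    obtain ⟨n, hn⟩ := exists_nat_ge K
    refine iInf_le_of_le n (iSup_le fun k => iInf_le_of_le ⟨φ, hφ, hK.weaken hn⟩ ?_)
    refine lintegral_mono fun y => ?_
    rw [hfa, ← iSup_truncSup]
    exact le_iSup (fun k => truncSup θ k a (ξ + grad φ y)) k

theorem measurable_Zfun {N m : ℕ} {f : (Fin N → ℝ) → (Fin m → Fin N → ℝ) → ℝ≥0∞}
    (hf : NormalIntegrand f) (hfin : ∀ x ξ, Zfun f x ξ ≠ ⊤) (ξ : Fin m → Fin N → ℝ) :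
    Measurable fun x => Zfun f x ξ := by
  obtain ⟨a, θ, ha, hθ, hθ1, hfa⟩ := exists_eq_iSup_mul hf.1 hf.2
  simp_rw [fun x => Zfun_eq_iInf_iSup (hfin x) hθ (hfa x) ξ]
  refine Measurable.iInf fun n => Measurable.iSup fun k => ?_
  exact (upperSemicontinuous_iInf fun φ : {φ : (Fin N → ℝ) → Fin m → ℝ //
    LipZero (unitCube N) φ ∧ LipschitzWith n φ} =>
      upperSemicontinuous_lintegral_truncSup hθ1 k fun y => ξ + grad φ.1 y).measurable.comp
    (measurable_pi_lambda (fun x j => a j x) ha)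

theorem stmt2 {N m : ℕ} (f : (Fin N → ℝ) → (Fin m → Fin N → ℝ) → ℝ≥0∞)
    (hf : NormalIntegrand f) :
    (∀ x, (∀ ξ, Zfun f x ξ ≠ ⊤) → Continuous (Zfun f x)) ∧
    ((∀ x ξ, Zfun f x ξ ≠ ⊤) →
      (∀ ξ, Measurable fun x => Zfun f x ξ) ∧ ∀ x, Continuous (Zfun f x)) := by
  exact ⟨fun _ hfin => continuous_Zfun hfin, fun hfin =>
    ⟨measurable_Zfun hf hfin, fun x => continuous_Zfun (hfin x)⟩⟩
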